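/- Let Ω ⊂ ℝⁿ be a smooth bounded domain with n ∈ {2,3}, let g be a C^∞ function, and let u, smooth on the closure of Ω, be a semi-stable classical solution of −Δu = g(u) in Ω with u = 0 on ∂Ω. Then there exists a constant C(n) depending only on n such that for every s > 0 one has ‖u‖_{L^∞(Ω)} ≤ s + (C(n)/s) |Ω|^{(4−n)/(2n)} ( ∫_{{|u| ≤ s}} |∇u|⁴ dx )^{1/2}. -/

import Mathlib

open MeasureTheory Filter Bornology
open scoped ENNReal Topology

/-- Divergence of a vector field on `ℝⁿ = EuclideanSpace ℝ (Fin n)`. -/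
noncomputable def divg {n : ℕ} (V : EuclideanSpace ℝ (Fin n) → EuclideanSpace ℝ (Fin n))
    (x : EuclideanSpace ℝ (Fin n)) : ℝ :=
  ∑ i, fderiv ℝ V x (EuclideanSpace.single i 1) i

/-- `H_u(x) = -(1/(n-1)) div(∇u/|∇u|)(x)`, the mean curvature of the level set of `|u|`
through `x` (at points where `∇u(x) ≠ 0`). -/
noncomputable def meanCurv {n : ℕ} (u : EuclideanSpace ℝ (Fin n) → ℝ)
    (x : EuclideanSpace ℝ (Fin n)) : ℝ :=
  -(1 / ((n : ℝ) - 1)) * divg (fun y => ‖gradient u y‖⁻¹ • gradient u y) x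

/-- The Laplacian `Δu = div ∇u` on `ℝⁿ`. -/
noncomputable def lap {n : ℕ} (u : EuclideanSpace ℝ (Fin n) → ℝ)
    (x : EuclideanSpace ℝ (Fin n)) : ℝ :=
  divg (gradient u) x

/-- Semi-stability of a solution `u` of `-Δu = g(u)` in `Ω`, `u = 0` on `∂Ω`:
`∫_Ω (|∇ξ|² - g'(u) ξ²) dx ≥ 0` for every `C¹` function `ξ` vanishing on `∂Ω`. -/
def SemiStable {n : ℕ} (Ω : Set (EuclideanSpace ℝ (Fin n))) (g : ℝ → ℝ)
    (u : EuclideanSpace ℝ (Fin n) → ℝ) : Prop :=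
  ∀ ξ : EuclideanSpace ℝ (Fin n) → ℝ, ContDiff ℝ 1 ξ → (∀ x ∈ frontier Ω, ξ x = 0) →
    0 ≤ ∫ x in Ω, (‖gradient ξ x‖ ^ 2 - deriv g (u x) * ξ x ^ 2)

/-- The partial derivative `∂ᵢ f`. -/
noncomputable def pd {n : ℕ} (i : Fin n) (f : EuclideanSpace ℝ (Fin n) → ℝ)
    (x : EuclideanSpace ℝ (Fin n)) : ℝ :=
  fderiv ℝ f x (EuclideanSpace.single i 1)

section PartialDerivatives

variable {n : ℕ} {f g : EuclideanSpace ℝ (Fin n) → ℝ} {x : EuclideanSpace ℝ (Fin n)}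

@[fun_prop]
theorem ContDiff.pd (hf : ContDiff ℝ (⊤ : ℕ∞) f) (i : Fin n) :
    ContDiff ℝ (⊤ : ℕ∞) (_root_.pd i f) := by
  unfold _root_.pd
  exact (hf.fderiv_right (m := (⊤ : ℕ∞)) (by simp)).clm_apply contDiff_const

theorem pd_comm (hf : ContDiff ℝ (⊤ : ℕ∞) f) (i j : Fin n) (x : EuclideanSpace ℝ (Fin n)) :
    pd i (pd j f) x = pd j (pd i f) x := by
  have hd : DifferentiableAt ℝ (fderiv ℝ f) x :=
    (hf.fderiv_right (m := (⊤ : ℕ∞)) (by simp)).differentiable (by simp) x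
  have key : ∀ i j : Fin n, pd i (pd j f) x =
      fderiv ℝ (fderiv ℝ f) x (EuclideanSpace.single i 1) (EuclideanSpace.single j 1) := by
    intro i j
    unfold pd
    rw [fderiv_clm_apply hd (differentiableAt_const _)]
    simp
  rw [key, key]
  exact (hf.contDiffAt.isSymmSndFDerivAt (by
    rw [minSmoothness_of_isRCLikeNormedField]
    exact WithTop.coe_le_coe.2 (le_top : (2 : ℕ∞) ≤ ⊤))).eq _ _

theorem pd_mul (hf : DifferentiableAt ℝ f x) (hg : DifferentiableAt ℝ g x) (i : Fin n) :
    pd i (fun y => f y * g y) x = f x * pd i g x + pd i f x * g x := by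
  unfold pd
  rw [fderiv_fun_mul hf hg]
  simp [mul_comm]

theorem pd_sub (hf : DifferentiableAt ℝ f x) (hg : DifferentiableAt ℝ g x) (i : Fin n) :
    pd i (fun y => f y - g y) x = pd i f x - pd i g x := by
  unfold pd
  rw [fderiv_fun_sub hf hg]
  simp

theorem pd_sum {ι : Type*} {s : Finset ι} {F : ι → EuclideanSpace ℝ (Fin n) → ℝ}
    (hF : ∀ j ∈ s, DifferentiableAt ℝ (F j) x) (i : Fin n) :
    pd i (fun y => ∑ j ∈ s, F j y) x = ∑ j ∈ s, pd i (F j) x := by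
  unfold pd
  rw [fderiv_fun_sum hF]
  simp

theorem pd_comp {φ : ℝ → ℝ} {φ' : ℝ} (hφ : HasDerivAt φ φ' (f x))
    (hf : DifferentiableAt ℝ f x) (i : Fin n) :
    pd i (fun y => φ (f y)) x = φ' * pd i f x := by
  unfold pd
  have h : HasFDerivAt (fun y => φ (f y)) _ x := hφ.comp_hasFDerivAt x hf.hasFDerivAt
  rw [h.fderiv]
  simp

theorem pd_coord_sub (a : EuclideanSpace ℝ (Fin n)) (i j : Fin n) :
    pd i (fun y => y j - a j) x = if i = j then 1 else 0 := by
  unfold pd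
  have h : HasFDerivAt (fun y : EuclideanSpace ℝ (Fin n) => y j - a j)
      (EuclideanSpace.proj j : EuclideanSpace ℝ (Fin n) →L[ℝ] ℝ) x :=
    (EuclideanSpace.proj j : EuclideanSpace ℝ (Fin n) →L[ℝ] ℝ).hasFDerivAt.sub_const _
  rw [h.fderiv]
  simp [eq_comm]

theorem pd_congr (h : f =ᶠ[𝓝 x] g) (i : Fin n) : pd i f x = pd i g x := by
  unfold pd; rw [h.fderiv_eq]

theorem gradient_apply_eq_pd (i : Fin n) (f : EuclideanSpace ℝ (Fin n) → ℝ)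
    (x : EuclideanSpace ℝ (Fin n)) : gradient f x i = pd i f x := by
  unfold pd
  rw [← toDual_gradient, InnerProductSpace.toDual_apply_apply, EuclideanSpace.inner_single_right]
  simp

theorem norm_gradient_sq (f : EuclideanSpace ℝ (Fin n) → ℝ) (x : EuclideanSpace ℝ (Fin n)) :
    ‖gradient f x‖ ^ 2 = ∑ i, pd i f x ^ 2 := by
  rw [EuclideanSpace.norm_sq_eq]
  simp [gradient_apply_eq_pd]

theorem norm_fderiv_sq (f : EuclideanSpace ℝ (Fin n) → ℝ) (x : EuclideanSpace ℝ (Fin n)) :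
    ‖fderiv ℝ f x‖ ^ 2 = ∑ i, pd i f x ^ 2 := by
  rw [← norm_gradient_sq, ← toDual_gradient, LinearIsometryEquiv.norm_map]

theorem lap_eq_sum_pd (hf : ContDiff ℝ (⊤ : ℕ∞) f) (x : EuclideanSpace ℝ (Fin n)) :
    lap f x = ∑ i, pd i (pd i f) x := by
  have hd : DifferentiableAt ℝ (gradient f) x := by
    have : ContDiff ℝ (⊤ : ℕ∞) (gradient f) := by
      unfold gradient
      exact (InnerProductSpace.toDual ℝ (EuclideanSpace ℝ (Fin n))).symm.contDiff.comp
        (hf.fderiv_right (m := (⊤ : ℕ∞)) (by simp))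
    exact this.differentiable (by simp) x
  unfold lap divg
  refine Finset.sum_congr rfl fun i _ => ?_
  have h1 : pd i f = fun y => (EuclideanSpace.proj i : EuclideanSpace ℝ (Fin n) →L[ℝ] ℝ)
      (gradient f y) := by
    funext y; simp [gradient_apply_eq_pd]
  have h2 : pd i (pd i f) x = fderiv ℝ (pd i f) x (EuclideanSpace.single i 1) := rfl
  have h3 : HasFDerivAt (fun y => (EuclideanSpace.proj i : EuclideanSpace ℝ (Fin n) →L[ℝ] ℝ)
      (gradient f y)) _ x :=
    (EuclideanSpace.proj i : EuclideanSpace ℝ (Fin n) →L[ℝ] ℝ).hasFDerivAt.comp x hd.hasFDerivAt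
  rw [h2, h1, h3.fderiv]
  simp

theorem integral_pd_eq_zero (hf : ContDiff ℝ 1 f) (hc : HasCompactSupport f) (i : Fin n) :
    ∫ x, pd i f x = 0 := by
  have hcont : Continuous (pd i f) := by
    unfold pd
    exact (hf.continuous_fderiv (by simp)).clm_apply continuous_const
  have hc' : HasCompactSupport (pd i f) := by
    unfold pd
    exact hc.fderiv_apply ℝ _
  have h := integral_mul_fderiv_eq_neg_fderiv_mul_of_integrable (𝕜 := ℝ)
    (μ := (volume : Measure (EuclideanSpace ℝ (Fin n))))
    (f := fun _ => (1 : ℝ)) (g := f) (v := EuclideanSpace.single i 1)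
    (by simp) (by simp only [one_mul]; exact hcont.integrable_of_hasCompactSupport hc')
    (by simp only [one_mul]; exact hf.continuous.integrable_of_hasCompactSupport hc)
    (fun x _ => differentiableAt_const _) (fun x _ => hf.differentiable (by simp) x)
  simpa [pd] using h

end PartialDerivatives

/-- `|∇u|²`. -/
noncomputable def gradSq {n : ℕ} (u : EuclideanSpace ℝ (Fin n) → ℝ)
    (x : EuclideanSpace ℝ (Fin n)) : ℝ :=
  ∑ j, pd j u x ^ 2

/-- The `i`-th component of `D²u ∇u`. -/
noncomputable def hessGrad {n : ℕ} (u : EuclideanSpace ℝ (Fin n) → ℝ) (i : Fin n)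
    (x : EuclideanSpace ℝ (Fin n)) : ℝ :=
  ∑ j, pd i (pd j u) x * pd j u x

/-- `|D²u|² - |D²u ∇u|² / (|∇u|² + c)`; for `c = 0` this is the squared norm of the
tangential part of the Hessian. -/
noncomputable def tangHess {n : ℕ} (c : ℝ) (u : EuclideanSpace ℝ (Fin n) → ℝ)
    (x : EuclideanSpace ℝ (Fin n)) : ℝ :=
  ∑ i, ∑ j, pd i (pd j u) x ^ 2 - (∑ i, hessGrad u i x ^ 2) / (gradSq u x + c)

/-- `Δu - D²u(∇u, ∇u) / (|∇u|² + c)`; for `c = 0` this is `|∇u|` times the (unnormalized) mean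
curvature of the level sets. -/
noncomputable def tangLap {n : ℕ} (c : ℝ) (u : EuclideanSpace ℝ (Fin n) → ℝ)
    (x : EuclideanSpace ℝ (Fin n)) : ℝ :=
  ∑ i, pd i (pd i u) x - (∑ i, pd i u x * hessGrad u i x) / (gradSq u x + c)

theorem sq_trace_sub_le {n : ℕ} (A : Fin n → Fin n → ℝ) (p : Fin n → ℝ) (hp : ∑ j, p j ^ 2 ≤ 1) :
    (∑ i, (A i i - p i * ∑ j, A i j * p j)) ^ 2 ≤
      n * ∑ i, (∑ j, A i j ^ 2 - (∑ j, A i j * p j) ^ 2) := by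
  set T := ∑ i, (∑ j, A i j ^ 2 - (∑ j, A i j * p j) ^ 2) with hT
  set L := ∑ i, (A i i - p i * ∑ j, A i j * p j) with hL
  have key : ∀ t : ℝ, 0 ≤ T - 2 * t * L + t ^ 2 * n := by
    intro t
    have h1 : ∀ i, 0 ≤ (∑ j, A i j ^ 2 - (∑ j, A i j * p j) ^ 2)
        - 2 * t * (A i i - p i * ∑ j, A i j * p j) + t ^ 2 * (1 - p i ^ 2) := by
      intro i
      have hcs := Finset.sum_mul_sq_le_sq_mul_sq Finset.univ
        (fun j => A i j - t * (if i = j then 1 else 0)) p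
      have e1 : ∑ j, (A i j - t * (if i = j then 1 else 0)) * p j
          = ∑ j, A i j * p j - t * p i := by
        simp [sub_mul, Finset.sum_sub_distrib]
      have e2 : ∑ j, (A i j - t * (if i = j then 1 else 0)) ^ 2
          = ∑ j, A i j ^ 2 - 2 * t * A i i + t ^ 2 := by
        have : ∀ j, (A i j - t * (if i = j then 1 else 0)) ^ 2
            = A i j ^ 2 - (if i = j then 2 * t * A i j else 0) + (if i = j then t ^ 2 else 0) := by
          intro j; split_ifs <;> ring
        simp only [this, Finset.sum_add_distrib, Finset.sum_sub_distrib]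
        simp
      rw [e1, e2] at hcs
      have h0 : 0 ≤ ∑ j, A i j ^ 2 - 2 * t * A i i + t ^ 2 := by
        rw [← e2]; positivity
      nlinarith
    have h2 := Finset.sum_nonneg fun i (_ : i ∈ Finset.univ) => h1 i
    rw [Finset.sum_add_distrib, Finset.sum_sub_distrib, ← Finset.mul_sum, ← Finset.mul_sum,
      ← hT, ← hL, Finset.sum_sub_distrib] at h2
    have h3 : 0 ≤ ∑ i, p i ^ 2 := by positivity
    simp only [Finset.sum_const, Finset.card_univ, Fintype.card_fin, nsmul_eq_mul, mul_one] at h2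
    nlinarith [sq_nonneg t, mul_nonneg (sq_nonneg t) h3]
  rcases Nat.eq_zero_or_pos n with rfl | hn
  · simp [hL]
  · have hn' : (0 : ℝ) < n := by exact_mod_cast hn
    have h := key (L / n)
    have e : T - 2 * (L / n) * L + (L / n) ^ 2 * n = T - L ^ 2 / n := by field_simp; ring
    rw [e, sub_nonneg, div_le_iff₀ hn'] at h
    linarith

section TangentialHessian

variable {n : ℕ} {u : EuclideanSpace ℝ (Fin n) → ℝ} {c : ℝ}

theorem gradSq_nonneg (u : EuclideanSpace ℝ (Fin n) → ℝ) (x : EuclideanSpace ℝ (Fin n)) :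
    0 ≤ gradSq u x := by
  unfold gradSq; positivity

theorem sq_tangLap_le (hc : 0 ≤ c) (x : EuclideanSpace ℝ (Fin n)) :
    tangLap c u x ^ 2 ≤ n * tangHess c u x := by
  have hq := gradSq_nonneg u x
  have hs : Real.sqrt (gradSq u x + c) ^ 2 = gradSq u x + c := Real.sq_sqrt (by linarith)
  have h := sq_trace_sub_le (fun i j => pd i (pd j u) x)
    (fun j => pd j u x / Real.sqrt (gradSq u x + c)) (by
      simp only [div_pow, hs, ← Finset.sum_div]
      exact div_le_one_of_le₀ (by unfold gradSq at *; linarith) (by linarith))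
  have e1 : ∀ i, ∑ j, pd i (pd j u) x * (pd j u x / Real.sqrt (gradSq u x + c))
      = hessGrad u i x / Real.sqrt (gradSq u x + c) := by
    intro i
    simp only [hessGrad, Finset.sum_div, mul_div_assoc]
  have e2 : ∀ i, pd i u x / Real.sqrt (gradSq u x + c)
      * (hessGrad u i x / Real.sqrt (gradSq u x + c))
      = pd i u x * hessGrad u i x / (gradSq u x + c) := by
    intro i
    rw [div_mul_div_comm, ← sq, hs]
  simp only [e1, e2, div_pow, hs, Finset.sum_sub_distrib, ← Finset.sum_div] at h
  simpa only [tangLap, tangHess] using h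

theorem tangHess_nonneg (hc : 0 ≤ c) (x : EuclideanSpace ℝ (Fin n)) : 0 ≤ tangHess c u x := by
  rcases Nat.eq_zero_or_pos n with rfl | hn
  · simp [tangHess]
  · have hn' : (0 : ℝ) < n := by exact_mod_cast hn
    exact nonneg_of_mul_nonneg_right ((sq_nonneg _).trans (sq_tangLap_le hc x)) hn'

theorem tangHess_le (hc : 0 ≤ c) (x : EuclideanSpace ℝ (Fin n)) :
    tangHess c u x ≤ ∑ i, ∑ j, pd i (pd j u) x ^ 2 := by
  have hq := gradSq_nonneg u x
  unfold tangHess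
  have : 0 ≤ (∑ i, hessGrad u i x ^ 2) / (gradSq u x + c) := by positivity
  linarith

theorem hessGrad_eq_zero {x : EuclideanSpace ℝ (Fin n)} (h : gradSq u x = 0) (i : Fin n) :
    hessGrad u i x = 0 := by
  have : ∀ j, pd j u x = 0 := by
    intro j
    have := (Finset.sum_eq_zero_iff_of_nonneg (fun j _ => sq_nonneg (pd j u x))).1 h j
      (Finset.mem_univ _)
    simpa using this
  simp [hessGrad, this]

theorem tangHess_zero_le (hc : 0 ≤ c) (x : EuclideanSpace ℝ (Fin n)) :
    tangHess 0 u x ≤ tangHess c u x := by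
  unfold tangHess
  rcases (gradSq_nonneg u x).eq_or_lt with h | h
  · simp [hessGrad_eq_zero h.symm]
  · gcongr

theorem abs_tangLap_le (hc : 0 ≤ c) (x : EuclideanSpace ℝ (Fin n)) :
    |tangLap c u x| ≤ Real.sqrt (n * ∑ i, ∑ j, pd i (pd j u) x ^ 2) := by
  apply Real.abs_le_sqrt
  exact (sq_tangLap_le hc x).trans (mul_le_mul_of_nonneg_left (tangHess_le hc x) (by positivity))

theorem tendsto_tangLap (x : EuclideanSpace ℝ (Fin n)) :
    Tendsto (fun c => tangLap c u x) (𝓝 0) (𝓝 (tangLap 0 u x)) := by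
  unfold tangLap
  rcases (gradSq_nonneg u x).eq_or_lt with h | h
  · simp [hessGrad_eq_zero h.symm]
  · refine tendsto_const_nhds.sub (tendsto_const_nhds.div
      (tendsto_const_nhds.add tendsto_id) (by simpa using h.ne'))

theorem contDiff_gradSq (hu : ContDiff ℝ (⊤ : ℕ∞) u) : ContDiff ℝ (⊤ : ℕ∞) (gradSq u) := by
  unfold gradSq
  exact ContDiff.sum fun j _ => (hu.pd j).pow 2

theorem contDiff_hessGrad (hu : ContDiff ℝ (⊤ : ℕ∞) u) (i : Fin n) :
    ContDiff ℝ (⊤ : ℕ∞) (hessGrad u i) := by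
  unfold hessGrad
  exact ContDiff.sum fun j _ => ((hu.pd j).pd i).mul (hu.pd j)

theorem continuous_sum_hess_sq (hu : ContDiff ℝ (⊤ : ℕ∞) u) :
    Continuous fun x => ∑ i, ∑ j, pd i (pd j u) x ^ 2 :=
  continuous_finsetSum _ fun i _ => continuous_finsetSum _ fun j _ =>
    ((hu.pd j).pd i).continuous.pow 2

theorem measurable_tangHess (hu : ContDiff ℝ (⊤ : ℕ∞) u) : Measurable (tangHess c u) := by
  unfold tangHess
  refine (continuous_sum_hess_sq hu).measurable.sub (Measurable.div ?_ ?_)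
  · exact (continuous_finsetSum _ fun i _ => (contDiff_hessGrad hu i).continuous.pow 2).measurable
  · exact ((contDiff_gradSq hu).continuous.add continuous_const).measurable

theorem measurable_tangLap (hu : ContDiff ℝ (⊤ : ℕ∞) u) : Measurable (tangLap c u) := by
  unfold tangLap
  refine Measurable.sub ?_ (Measurable.div ?_ ?_)
  · exact (continuous_finsetSum _ fun i _ => ((hu.pd i).pd i).continuous).measurable
  · exact (continuous_finsetSum _ fun i _ => (hu.pd i).continuous.mul
      (contDiff_hessGrad hu i).continuous).measurable
  · exact ((contDiff_gradSq hu).continuous.add continuous_const).measurable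

theorem pd_gradSq (hu : ContDiff ℝ (⊤ : ℕ∞) u)
    (i : Fin n) (x : EuclideanSpace ℝ (Fin n)) :
    pd i (gradSq u) x = 2 * hessGrad u i x := by
  have hd : ∀ j, DifferentiableAt ℝ (pd j u) x := fun j => (hu.pd j).differentiable (by simp) x
  have : gradSq u = fun y => ∑ j, pd j u y * pd j u y := by
    funext y; simp only [gradSq, sq]
  rw [this, pd_sum (F := fun j y => pd j u y * pd j u y) (fun j _ => (hd j).mul (hd j)),
    hessGrad, Finset.mul_sum]
  refine Finset.sum_congr rfl fun j _ => ?_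
  rw [pd_mul (hd j) (hd j)]; ring

/-- Regularized norm of the gradient. -/
theorem contDiff_sqrt_gradSq_add (hu : ContDiff ℝ (⊤ : ℕ∞) u) (hc : 0 < c) :
    ContDiff ℝ (⊤ : ℕ∞) fun y => Real.sqrt (gradSq u y + c) :=
  ((contDiff_gradSq hu).add contDiff_const).sqrt fun x => by
    have := gradSq_nonneg u x; positivity

theorem pd_sqrt_gradSq_add (hu : ContDiff ℝ (⊤ : ℕ∞) u) (hc : 0 < c)
    (i : Fin n) (x : EuclideanSpace ℝ (Fin n)) :
    pd i (fun y => Real.sqrt (gradSq u y + c)) x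
      = hessGrad u i x * (Real.sqrt (gradSq u x + c))⁻¹ := by
  have hpos : gradSq u x + c ≠ 0 := by have := gradSq_nonneg u x; positivity
  have h : HasDerivAt (fun t : ℝ => Real.sqrt (t + c)) (1 / (2 * Real.sqrt (gradSq u x + c)))
      (gradSq u x) := ((hasDerivAt_id (gradSq u x)).add_const c).sqrt hpos
  rw [pd_comp h ((contDiff_gradSq hu).differentiable (by simp) x), pd_gradSq hu]
  ring

theorem pd_inv_sqrt_gradSq_add (hu : ContDiff ℝ (⊤ : ℕ∞) u) (hc : 0 < c)
    (i : Fin n) (x : EuclideanSpace ℝ (Fin n)) :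
    pd i (fun y => (Real.sqrt (gradSq u y + c))⁻¹) x
      = -(hessGrad u i x * (Real.sqrt (gradSq u x + c))⁻¹ ^ 3) := by
  have hpos : 0 < Real.sqrt (gradSq u x + c) := by
    have := gradSq_nonneg u x; apply Real.sqrt_pos.2; positivity
  rw [pd_comp (f := fun y => Real.sqrt (gradSq u y + c)) (hasDerivAt_inv hpos.ne')
    ((contDiff_sqrt_gradSq_add hu hc).differentiable (by simp) x), pd_sqrt_gradSq_add hu hc]
  field_simp

end TangentialHessian

section Stability

variable {n : ℕ} {Ω : Set (EuclideanSpace ℝ (Fin n))} {g : ℝ → ℝ}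
  {u θ : EuclideanSpace ℝ (Fin n) → ℝ} {c : ℝ}

theorem sum_pd_pd_pd_mul (hu : ContDiff ℝ (⊤ : ℕ∞) u) (hg : ContDiff ℝ (⊤ : ℕ∞) g)
    (hΩ : IsOpen Ω) (heq : ∀ x ∈ Ω, -lap u x = g (u x)) {x : EuclideanSpace ℝ (Fin n)}
    (hx : x ∈ Ω) (j : Fin n) :
    ∑ i, pd i (pd i (pd j u)) x = -(deriv g (u x) * pd j u x) := by
  have h1 : ∀ i, pd i (pd i (pd j u)) x = pd j (pd i (pd i u)) x := by
    intro i
    have : pd i (pd j u) = pd j (pd i u) := funext fun y => pd_comm hu i j y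
    rw [this, pd_comm (hu.pd i)]
  simp only [h1]
  rw [← pd_sum (F := fun i => pd i (pd i u))
    fun i _ => ((hu.pd i).pd i).differentiable (by simp) x]
  have h2 : (fun y => ∑ i, pd i (pd i u) y) =ᶠ[𝓝 x] fun y => -g (u y) := by
    filter_upwards [hΩ.mem_nhds hx] with y hy
    rw [← lap_eq_sum_pd hu, ← heq y hy, neg_neg]
  have h3 : HasDerivAt (fun t => -g t) (-deriv g (u x)) (u x) :=
    (hg.differentiable (by simp) (u x)).hasDerivAt.neg
  rw [pd_congr h2, pd_comp h3 (hu.differentiable (by simp) x)]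
  ring

theorem pd_eq_zero_of_notMem_tsupport {x : EuclideanSpace ℝ (Fin n)} (hx : x ∉ tsupport θ)
    (i : Fin n) : pd i θ x = 0 := by
  have : fderiv ℝ θ x = 0 := by
    by_contra h
    exact hx (support_fderiv_subset ℝ h)
  simp [pd, this]

theorem integrable_sq_mul_tangHess (hu : ContDiff ℝ (⊤ : ℕ∞) u) (hθ : ContDiff ℝ (⊤ : ℕ∞) θ)
    (hc : HasCompactSupport θ) {c : ℝ} (hc0 : 0 ≤ c) :
    Integrable fun x => θ x ^ 2 * tangHess c u x := by
  have h1 : Integrable fun x => θ x ^ 2 * ∑ i, ∑ j, pd i (pd j u) x ^ 2 := by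
    apply Continuous.integrable_of_hasCompactSupport
    · exact (hθ.continuous.pow 2).mul (continuous_sum_hess_sq hu)
    · exact HasCompactSupport.mul_right (hc.comp_left (g := fun t : ℝ => t ^ 2) (by simp))
  refine h1.mono' ?_ (Eventually.of_forall fun x => ?_)
  · exact ((hθ.continuous.pow 2).measurable.mul (measurable_tangHess hu)).aestronglyMeasurable
  · rw [Real.norm_of_nonneg (mul_nonneg (sq_nonneg _) (tangHess_nonneg hc0 x))]
    exact mul_le_mul_of_nonneg_left (tangHess_le hc0 x) (sq_nonneg _)

theorem pd_mul_mul_hessGrad (hu : ContDiff ℝ (⊤ : ℕ∞) u) (hθ : ContDiff ℝ (⊤ : ℕ∞) θ)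
    (i : Fin n) (x : EuclideanSpace ℝ (Fin n)) :
    pd i (fun y => θ y * (θ y * hessGrad u i y)) x =
      2 * θ x * (pd i θ x * hessGrad u i x) + θ x ^ 2 *
        (∑ j, pd i (pd j u) x ^ 2 + ∑ j, pd i (pd i (pd j u)) x * pd j u x) := by
  have dθ := hθ.differentiable (by simp) x
  have dS := (contDiff_hessGrad hu i).differentiable (by simp) x
  have e : pd i (hessGrad u i) x =
      ∑ j, pd i (pd j u) x ^ 2 + ∑ j, pd i (pd i (pd j u)) x * pd j u x := by
    unfold hessGrad
    rw [pd_sum (F := fun j y => pd i (pd j u) y * pd j u y) (fun j _ =>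
      (((hu.pd j).pd i).differentiable (by simp) x).mul ((hu.pd j).differentiable (by simp) x)),
      ← Finset.sum_add_distrib]
    refine Finset.sum_congr rfl fun j _ => ?_
    rw [pd_mul (((hu.pd j).pd i).differentiable (by simp) x)
      ((hu.pd j).differentiable (by simp) x)]
    ring
  rw [pd_mul (g := fun y => θ y * hessGrad u i y) dθ (dθ.mul dS), pd_mul dθ dS, e]
  ring

theorem norm_gradient_sq_sub_eq (hu : ContDiff ℝ (⊤ : ℕ∞) u)
    (hg : ContDiff ℝ (⊤ : ℕ∞) g) (hΩ : IsOpen Ω) (heq : ∀ x ∈ Ω, -lap u x = g (u x))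
    (hθ : ContDiff ℝ (⊤ : ℕ∞) θ) (hc : 0 < c) {x : EuclideanSpace ℝ (Fin n)} (hx : x ∈ Ω) :
    ‖gradient (fun y => Real.sqrt (gradSq u y + c) * θ y) x‖ ^ 2
        - deriv g (u x) * (Real.sqrt (gradSq u x + c) * θ x) ^ 2 =
      ∑ i, pd i (fun y => θ y * (θ y * hessGrad u i y)) x + gradSq u x * ∑ i, pd i θ x ^ 2
        - θ x ^ 2 * tangHess c u x + c * (∑ i, pd i θ x ^ 2 - deriv g (u x) * θ x ^ 2) := by
  have hpos : 0 < gradSq u x + c := by have := gradSq_nonneg u x; positivity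
  have hNpos := Real.sqrt_pos.2 hpos
  have hsq := Real.sq_sqrt hpos.le
  have e0 : ∀ i, pd i (fun y => Real.sqrt (gradSq u y + c) * θ y) x ^ 2 =
      (gradSq u x + c) * pd i θ x ^ 2 + 2 * θ x * (pd i θ x * hessGrad u i x)
        + θ x ^ 2 / (gradSq u x + c) * hessGrad u i x ^ 2 := by
    intro i
    rw [pd_mul ((contDiff_sqrt_gradSq_add hu hc).differentiable (by simp) x)
      (hθ.differentiable (by simp) x), pd_sqrt_gradSq_add hu hc]
    generalize Real.sqrt (gradSq u x + c) = N at hNpos hsq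
    rw [← hsq]
    field_simp
    ring
  have e2 : ∑ i, ∑ j, pd i (pd i (pd j u)) x * pd j u x = -(deriv g (u x) * gradSq u x) := by
    rw [Finset.sum_comm]
    simp only [← Finset.sum_mul, sum_pd_pd_pd_mul hu hg hΩ heq hx, gradSq, Finset.mul_sum,
      ← Finset.sum_neg_distrib]
    exact Finset.sum_congr rfl fun j _ => by ring
  rw [norm_gradient_sq]
  simp only [e0, pd_mul_mul_hessGrad hu hθ, Finset.sum_add_distrib, ← Finset.mul_sum, e2,
    mul_pow, hsq, tangHess]
  field_simp
  ring

/-- The second variation along the test function `√(|∇u|² + c) θ`. -/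
theorem integral_sq_mul_tangHess_le_add (hu : ContDiff ℝ (⊤ : ℕ∞) u)
    (hg : ContDiff ℝ (⊤ : ℕ∞) g) (hΩ : IsOpen Ω) (heq : ∀ x ∈ Ω, -lap u x = g (u x))
    (hst : SemiStable Ω g u) (hθ : ContDiff ℝ (⊤ : ℕ∞) θ) (hcs : HasCompactSupport θ)
    (hsub : tsupport θ ⊆ Ω) (hc : 0 < c) :
    ∫ x, θ x ^ 2 * tangHess c u x ≤
      (∫ x, gradSq u x * ∑ i, pd i θ x ^ 2) +
        c * ∫ x, (∑ i, pd i θ x ^ 2 - deriv g (u x) * θ x ^ 2) := by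
  have hst' := hst (fun y => Real.sqrt (gradSq u y + c) * θ y)
    (((contDiff_sqrt_gradSq_add hu hc).mul hθ).of_le (by exact_mod_cast le_top)) fun x hx => by
      have hx' : x ∉ tsupport θ := fun h =>
        (disjoint_frontier_iff_isOpen.2 hΩ).le_bot ⟨hx, hsub h⟩
      simp [image_eq_zero_of_notMem_tsupport hx']
  have hWs : ∀ i, ContDiff ℝ (⊤ : ℕ∞) fun y => θ y * (θ y * hessGrad u i y) := fun i =>
    hθ.mul (hθ.mul (contDiff_hessGrad hu i))
  have hWc : ∀ i, HasCompactSupport fun y => θ y * (θ y * hessGrad u i y) := fun i =>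
    hcs.mul_right
  have iW' : ∀ i, Integrable (pd i fun y => θ y * (θ y * hessGrad u i y)) := fun i =>
    ((hWs i).pd i).continuous.integrable_of_hasCompactSupport ((hWc i).fderiv_apply ℝ _)
  have hWint : ∫ x, ∑ i, pd i (fun y => θ y * (θ y * hessGrad u i y)) x = 0 := by
    rw [integral_finsetSum _ fun i _ => iW' i]
    exact Finset.sum_eq_zero fun i _ =>
      integral_pd_eq_zero ((hWs i).of_le (by exact_mod_cast le_top)) (hWc i) i
  have hpt : (Ω.indicator fun x => ‖gradient (fun y => Real.sqrt (gradSq u y + c) * θ y) x‖ ^ 2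
        - deriv g (u x) * (Real.sqrt (gradSq u x + c) * θ x) ^ 2) = fun x =>
      ∑ i, pd i (fun y => θ y * (θ y * hessGrad u i y)) x + gradSq u x * ∑ i, pd i θ x ^ 2
        - θ x ^ 2 * tangHess c u x + c * (∑ i, pd i θ x ^ 2 - deriv g (u x) * θ x ^ 2) := by
    funext x
    by_cases hx : x ∈ Ω
    · rw [Set.indicator_of_mem hx]
      exact norm_gradient_sq_sub_eq hu hg hΩ heq hθ hc hx
    · have hx' : x ∉ tsupport θ := fun h => hx (hsub h)
      rw [Set.indicator_of_notMem hx]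
      simp [pd_mul_mul_hessGrad hu hθ, image_eq_zero_of_notMem_tsupport hx',
        pd_eq_zero_of_notMem_tsupport hx']
  rw [← integral_indicator hΩ.measurableSet, hpt] at hst'
  have iW : Integrable fun x => ∑ i, pd i (fun y => θ y * (θ y * hessGrad u i y)) x :=
    integrable_finsetSum _ fun i _ => iW' i
  have cθ : ∀ i, HasCompactSupport fun x => pd i θ x ^ 2 := fun i =>
    HasCompactSupport.comp_left (g := fun t : ℝ => t ^ 2) (hcs.fderiv_apply ℝ _) (by simp)
  have iθ : Integrable fun x => ∑ i, pd i θ x ^ 2 := integrable_finsetSum _ fun i _ =>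
    ((hθ.pd i).continuous.pow 2).integrable_of_hasCompactSupport (cθ i)
  have iq : Integrable fun x => gradSq u x * ∑ i, pd i θ x ^ 2 := by
    simp only [Finset.mul_sum]
    exact integrable_finsetSum _ fun i _ =>
      ((contDiff_gradSq hu).continuous.mul ((hθ.pd i).continuous.pow 2)
        ).integrable_of_hasCompactSupport (cθ i).mul_left
  have ig : Integrable fun x => deriv g (u x) * θ x ^ 2 := by
    apply Continuous.integrable_of_hasCompactSupport
    · exact ((hg.continuous_deriv (by simp)).comp hu.continuous).mul (hθ.continuous.pow 2)
    · exact HasCompactSupport.mul_left (hcs.comp_left (g := fun t : ℝ => t ^ 2) (by simp))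
  have iJ := integrable_sq_mul_tangHess hu hθ hcs hc.le
  have i1 : Integrable fun x => ∑ i, pd i (fun y => θ y * (θ y * hessGrad u i y)) x
      + gradSq u x * ∑ i, pd i θ x ^ 2 := iW.add iq
  have i2 : Integrable fun x => ∑ i, pd i (fun y => θ y * (θ y * hessGrad u i y)) x
      + gradSq u x * ∑ i, pd i θ x ^ 2 - θ x ^ 2 * tangHess c u x := i1.sub iJ
  have i3 : Integrable fun x => c * (∑ i, pd i θ x ^ 2 - deriv g (u x) * θ x ^ 2) :=
    (iθ.sub ig).const_mul c
  rw [integral_add i2 i3, integral_sub i1 iJ, integral_add iW iq, hWint,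
    integral_const_mul] at hst'
  linarith

/-- The geometric form of the semi-stability inequality. -/
theorem integral_sq_mul_tangHess_le (hu : ContDiff ℝ (⊤ : ℕ∞) u)
    (hg : ContDiff ℝ (⊤ : ℕ∞) g) (hΩ : IsOpen Ω) (heq : ∀ x ∈ Ω, -lap u x = g (u x))
    (hst : SemiStable Ω g u) (hθ : ContDiff ℝ (⊤ : ℕ∞) θ) (hcs : HasCompactSupport θ)
    (hsub : tsupport θ ⊆ Ω) :
    ∫ x, θ x ^ 2 * tangHess 0 u x ≤ ∫ x, gradSq u x * ∑ i, pd i θ x ^ 2 := by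
  have h : ∀ c : ℝ, 0 < c → ∫ x, θ x ^ 2 * tangHess 0 u x ≤
      (∫ x, gradSq u x * ∑ i, pd i θ x ^ 2) +
        c * ∫ x, (∑ i, pd i θ x ^ 2 - deriv g (u x) * θ x ^ 2) := fun c hc =>
    (integral_mono (integrable_sq_mul_tangHess hu hθ hcs le_rfl)
      (integrable_sq_mul_tangHess hu hθ hcs hc.le) fun x =>
        mul_le_mul_of_nonneg_left (tangHess_zero_le hc.le x) (sq_nonneg _)).trans
      (integral_sq_mul_tangHess_le_add hu hg hΩ heq hst hθ hcs hsub hc)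
  set A := ∫ x, gradSq u x * ∑ i, pd i θ x ^ 2
  set B := ∫ x, (∑ i, pd i θ x ^ 2 - deriv g (u x) * θ x ^ 2)
  have hlim : Tendsto (fun c : ℝ => A + c * B) (𝓝[>] 0) (𝓝 (A + 0 * B)) :=
    ((continuous_const.add (continuous_id.mul continuous_const)).tendsto 0).mono_left
      nhdsWithin_le_nhds
  rw [zero_mul, add_zero] at hlim
  exact ge_of_tendsto hlim (eventually_nhdsWithin_of_forall fun c hc => h c hc)

end Stability

section FirstVariation

variable {n : ℕ} {u θ τ Φ κ : EuclideanSpace ℝ (Fin n) → ℝ} {c : ℝ}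
  {a : EuclideanSpace ℝ (Fin n)}

theorem sum_pd_firstVariation_field (hu : ContDiff ℝ (⊤ : ℕ∞) u) (hθ : ContDiff ℝ (⊤ : ℕ∞) θ)
    (hΦ : ContDiff ℝ (⊤ : ℕ∞) Φ) (hc : 0 < c) (x : EuclideanSpace ℝ (Fin n))
    (hτ : ∀ i, pd i θ x = τ x * pd i u x) (hκ : ∀ i, pd i Φ x = -κ x * (x i - a i)) :
    ∑ i, pd i (fun y => θ y * (Φ y * (Real.sqrt (gradSq u y + c) * (y i - a i)
        - pd i u y * ((∑ j, (y j - a j) * pd j u y) * (Real.sqrt (gradSq u y + c))⁻¹)))) x =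
      τ x * Φ x * (∑ j, (x j - a j) * pd j u x) * c * (Real.sqrt (gradSq u x + c))⁻¹
      + θ x * (-κ x * (Real.sqrt (gradSq u x + c) * ∑ j, (x j - a j) ^ 2
          - (∑ j, (x j - a j) * pd j u x) ^ 2 * (Real.sqrt (gradSq u x + c))⁻¹)
        + Φ x * (n * Real.sqrt (gradSq u x + c)
          - gradSq u x * (Real.sqrt (gradSq u x + c))⁻¹))
      - θ x * Φ x * (∑ j, (x j - a j) * pd j u x) * (Real.sqrt (gradSq u x + c))⁻¹
        * tangLap c u x := by
  have hpos : 0 < gradSq u x + c := by have := gradSq_nonneg u x; positivity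
  have hNpos := Real.sqrt_pos.2 hpos
  have hsq := Real.sq_sqrt hpos.le
  have dθ := hθ.differentiable (by simp) x
  have dΦ := hΦ.differentiable (by simp) x
  have dN := (contDiff_sqrt_gradSq_add hu hc).differentiable (by simp) x
  have dR : DifferentiableAt ℝ (fun y => (Real.sqrt (gradSq u y + c))⁻¹) x := dN.inv hNpos.ne'
  have dy : ∀ j, DifferentiableAt ℝ (fun y : EuclideanSpace ℝ (Fin n) => y j - a j) x := by
    intro j; fun_prop
  have du : ∀ j, DifferentiableAt ℝ (pd j u) x := fun j => (hu.pd j).differentiable (by simp) x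
  have dyu : ∀ j, DifferentiableAt ℝ (fun y => (y j - a j) * pd j u y) x :=
    fun j => (dy j).mul (du j)
  have dZ : DifferentiableAt ℝ (fun y => ∑ j, (y j - a j) * pd j u y) x :=
    DifferentiableAt.fun_sum fun j _ => dyu j
  have pZ : ∀ i, pd i (fun y => ∑ j, (y j - a j) * pd j u y) x =
      pd i u x + ∑ j, (x j - a j) * pd i (pd j u) x := by
    intro i
    rw [pd_sum (F := fun j y => (y j - a j) * pd j u y) fun j _ => dyu j]
    have : ∀ j, pd i (fun y => (y j - a j) * pd j u y) x =
        (x j - a j) * pd i (pd j u) x + if i = j then pd j u x else 0 := by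
      intro j
      rw [pd_mul (dy j) (du j), pd_coord_sub, ite_mul, one_mul, zero_mul]
    simp only [this, Finset.sum_add_distrib]
    simp [add_comm]
  have hsymm : ∑ i, pd i u x * ∑ j, (x j - a j) * pd i (pd j u) x =
      ∑ i, (x i - a i) * hessGrad u i x := by
    simp only [hessGrad, Finset.mul_sum]
    rw [Finset.sum_comm]
    refine Finset.sum_congr rfl fun i _ => Finset.sum_congr rfl fun j _ => ?_
    rw [pd_comm hu j i]; ring
  set Z := ∑ j, (x j - a j) * pd j u x with hZ
  have hpd : ∀ i, pd i (fun y => θ y * (Φ y * (Real.sqrt (gradSq u y + c) * (y i - a i)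
        - pd i u y * ((∑ j, (y j - a j) * pd j u y) * (Real.sqrt (gradSq u y + c))⁻¹)))) x =
      τ x * Φ x * Real.sqrt (gradSq u x + c) * ((x i - a i) * pd i u x)
      - τ x * Φ x * Z * (Real.sqrt (gradSq u x + c))⁻¹ * pd i u x ^ 2
      - θ x * κ x * Real.sqrt (gradSq u x + c) * (x i - a i) ^ 2
      + θ x * κ x * Z * (Real.sqrt (gradSq u x + c))⁻¹ * ((x i - a i) * pd i u x)
      + θ x * Φ x * (Real.sqrt (gradSq u x + c))⁻¹ * ((x i - a i) * hessGrad u i x)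
      + θ x * Φ x * Real.sqrt (gradSq u x + c)
      - θ x * Φ x * Z * (Real.sqrt (gradSq u x + c))⁻¹ * pd i (pd i u) x
      - θ x * Φ x * (Real.sqrt (gradSq u x + c))⁻¹ * pd i u x ^ 2
      - θ x * Φ x * (Real.sqrt (gradSq u x + c))⁻¹
        * (pd i u x * ∑ j, (x j - a j) * pd i (pd j u) x)
      + θ x * Φ x * Z * (Real.sqrt (gradSq u x + c))⁻¹ ^ 3 * (pd i u x * hessGrad u i x) := by
    intro i
    have d1 : DifferentiableAt ℝ (fun y => Real.sqrt (gradSq u y + c) * (y i - a i)) x :=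
      dN.mul (dy i)
    have d2 : DifferentiableAt ℝ (fun y => (∑ j, (y j - a j) * pd j u y)
        * (Real.sqrt (gradSq u y + c))⁻¹) x := dZ.mul dR
    have d3 : DifferentiableAt ℝ (fun y => pd i u y * ((∑ j, (y j - a j) * pd j u y)
        * (Real.sqrt (gradSq u y + c))⁻¹)) x := (du i).mul d2
    rw [pd_mul dθ (dΦ.fun_mul (d1.fun_sub d3)), pd_mul dΦ (d1.fun_sub d3), pd_sub d1 d3,
      pd_mul dN (dy i), pd_mul (du i) d2, pd_mul dZ dR, pZ, pd_inv_sqrt_gradSq_add hu hc,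
      pd_sqrt_gradSq_add hu hc, pd_coord_sub, if_pos rfl, hτ, hκ, ← hZ]
    ring
  simp only [hpd, Finset.sum_add_distrib, Finset.sum_sub_distrib, ← Finset.mul_sum, hsymm, ← hZ]
  rw [← gradSq, tangLap]
  simp only [Finset.sum_const, Finset.card_univ, Fintype.card_fin, nsmul_eq_mul]
  generalize Real.sqrt (gradSq u x + c) = N at hNpos hsq
  have hq : gradSq u x = N ^ 2 - c := by linarith
  rw [hq]
  have : N ^ 2 - c + c = N ^ 2 := by ring
  rw [this]
  field_simp
  ring

theorem sq_norm_sub_eq_sum (x a : EuclideanSpace ℝ (Fin n)) :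
    ‖x - a‖ ^ 2 = ∑ j, (x j - a j) ^ 2 := by
  rw [EuclideanSpace.norm_sq_eq]; simp

theorem integrable_mul_abs_tangLap (hu : ContDiff ℝ (⊤ : ℕ∞) u) {f : EuclideanSpace ℝ (Fin n) → ℝ}
    (hf : Continuous f) (hcs : HasCompactSupport f) (hc : 0 ≤ c) :
    Integrable fun x => f x * |tangLap c u x| := by
  have h1 : Integrable fun x => |f x| * Real.sqrt (n * ∑ i, ∑ j, pd i (pd j u) x ^ 2) :=
    (hf.abs.mul (continuous_const.mul (continuous_sum_hess_sq hu)).sqrt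
      ).integrable_of_hasCompactSupport hcs.abs.mul_right
  refine h1.mono' ?_ (Eventually.of_forall fun x => ?_)
  · exact (hf.measurable.mul (measurable_tangLap hu).abs).aestronglyMeasurable
  · rw [norm_mul, Real.norm_eq_abs, Real.norm_eq_abs, abs_abs]
    exact mul_le_mul_of_nonneg_left (abs_tangLap_le hc x) (abs_nonneg _)

theorem tendsto_integral_mul_abs_tangLap (hu : ContDiff ℝ (⊤ : ℕ∞) u)
    {f : EuclideanSpace ℝ (Fin n) → ℝ} (hf : Continuous f) (hcs : HasCompactSupport f) :
    Tendsto (fun c => ∫ x, f x * |tangLap c u x|) (𝓝[>] 0)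
      (𝓝 (∫ x, f x * |tangLap 0 u x|)) := by
  have h1 : Integrable fun x => |f x| * Real.sqrt (n * ∑ i, ∑ j, pd i (pd j u) x ^ 2) :=
    (hf.abs.mul (continuous_const.mul (continuous_sum_hess_sq hu)).sqrt
      ).integrable_of_hasCompactSupport hcs.abs.mul_right
  refine tendsto_integral_filter_of_dominated_convergence _ ?_ ?_ h1 ?_
  · exact Eventually.of_forall fun c =>
      (hf.measurable.mul (measurable_tangLap hu).abs).aestronglyMeasurable
  · refine eventually_nhdsWithin_of_forall fun c hc => Eventually.of_forall fun x => ?_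
    rw [norm_mul, Real.norm_eq_abs, Real.norm_eq_abs, abs_abs]
    exact mul_le_mul_of_nonneg_left (abs_tangLap_le (le_of_lt hc) x) (abs_nonneg _)
  · exact Eventually.of_forall fun x =>
      ((tendsto_tangLap x).mono_left nhdsWithin_le_nhds).abs.const_mul _

/-- A weighted Minkowski-type inequality obtained by testing the first variation of the area of
the level sets of `u` with the vector field `Φ(x) (x - a)`. -/
theorem integral_mul_sqrt_gradSq_le (hu : ContDiff ℝ (⊤ : ℕ∞) u) (hθ : ContDiff ℝ (⊤ : ℕ∞) θ)
    (hθ0 : ∀ x, 0 ≤ θ x) (hθc : HasCompactSupport θ) (hΦ : ContDiff ℝ (⊤ : ℕ∞) Φ)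
    (hΦ0 : ∀ x, 0 ≤ Φ x) (hτc : Continuous τ) (hτs : HasCompactSupport τ)
    (hτ : ∀ i x, pd i θ x = τ x * pd i u x) (hκc : Continuous κ) (hκ0 : ∀ x, 0 ≤ κ x)
    (hκ : ∀ i x, pd i Φ x = -κ x * (x i - a i))
    (hpos : ∀ x, 0 ≤ (n - 1) * Φ x - κ x * ‖x - a‖ ^ 2) :
    ∫ x, θ x * (Real.sqrt (gradSq u x) * ((n - 1) * Φ x - κ x * ‖x - a‖ ^ 2)) ≤
      ∫ x, θ x * (Φ x * ‖x - a‖) * |tangLap 0 u x| := by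
  have cq := (contDiff_gradSq hu).continuous
  have cr : Continuous fun x : EuclideanSpace ℝ (Fin n) => ‖x - a‖ := by fun_prop
  have cw : Continuous fun x => θ x * (Φ x * ‖x - a‖) :=
    hθ.continuous.mul (hΦ.continuous.mul cr)
  have sw : HasCompactSupport fun x => θ x * (Φ x * ‖x - a‖) := hθc.mul_right
  have i0 : Integrable fun x =>
      θ x * (Real.sqrt (gradSq u x) * ((n - 1) * Φ x - κ x * ‖x - a‖ ^ 2)) :=
    (hθ.continuous.mul (cq.sqrt.mul ((continuous_const.mul hΦ.continuous).sub
      (hκc.mul (cr.pow 2))))).integrable_of_hasCompactSupport hθc.mul_right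
  have i1 : Integrable fun x => |τ x| * (Φ x * ‖x - a‖) :=
    (hτc.abs.mul (hΦ.continuous.mul cr)).integrable_of_hasCompactSupport hτs.abs.mul_right
  have key : ∀ c : ℝ, 0 < c →
      ∫ x, θ x * (Real.sqrt (gradSq u x) * ((n - 1) * Φ x - κ x * ‖x - a‖ ^ 2)) ≤
      (∫ x, θ x * (Φ x * ‖x - a‖) * |tangLap c u x|)
        + c * ∫ x, |τ x| * (Φ x * ‖x - a‖) := by
    intro c hc
    set V : Fin n → EuclideanSpace ℝ (Fin n) → ℝ := fun i y =>
      θ y * (Φ y * (Real.sqrt (gradSq u y + c) * (y i - a i)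
        - pd i u y * ((∑ j, (y j - a j) * pd j u y) * (Real.sqrt (gradSq u y + c))⁻¹))) with hV
    have hNs := contDiff_sqrt_gradSq_add hu hc
    have hN0 : ∀ y, Real.sqrt (gradSq u y + c) ≠ 0 := fun y => by
      have := gradSq_nonneg u y; positivity
    have hy : ∀ j, ContDiff ℝ (⊤ : ℕ∞) fun y : EuclideanSpace ℝ (Fin n) => y j - a j := by
      intro j; fun_prop
    have hVs : ∀ i, ContDiff ℝ (⊤ : ℕ∞) (V i) := fun i =>
      hθ.mul (hΦ.mul ((hNs.mul (hy i)).sub ((hu.pd i).mul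
        ((ContDiff.sum fun j _ => (hy j).mul (hu.pd j)).mul (hNs.inv hN0)))))
    have hVc : ∀ i, HasCompactSupport (V i) := fun i => hθc.mul_right
    have iV' : ∀ i, Integrable (pd i (V i)) := fun i =>
      ((hVs i).pd i).continuous.integrable_of_hasCompactSupport ((hVc i).fderiv_apply ℝ _)
    have iV : Integrable fun x => ∑ i, pd i (V i) x := integrable_finsetSum _ fun i _ => iV' i
    have hVint : ∫ x, ∑ i, pd i (V i) x = 0 := by
      rw [integral_finsetSum _ fun i _ => iV' i]
      exact Finset.sum_eq_zero fun i _ =>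
        integral_pd_eq_zero ((hVs i).of_le (by exact_mod_cast le_top)) (hVc i) i
    have i2 : Integrable fun x => θ x * (Φ x * ‖x - a‖) * |tangLap c u x| :=
      integrable_mul_abs_tangLap hu cw sw hc.le
    have i3 : Integrable fun x => c * (|τ x| * (Φ x * ‖x - a‖)) := i1.const_mul c
    have i4 : Integrable fun x => ∑ i, pd i (V i) x
        + θ x * (Φ x * ‖x - a‖) * |tangLap c u x| := iV.add i2
    have hwint := integral_mono i0 (i4.add i3) (fun x => ?_)
    · rw [integral_add' i4 i3, integral_add iV i2, hVint, integral_const_mul] at hwint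
      linarith
    · simp only [Pi.add_apply]
      rw [sum_pd_firstVariation_field hu hθ hΦ hc x (fun i => hτ i x) (fun i => hκ i x)]
      have hq0 := gradSq_nonneg u x
      have hNpos : 0 < Real.sqrt (gradSq u x + c) := Real.sqrt_pos.2 (by linarith)
      have hNsq : Real.sqrt (gradSq u x + c) ^ 2 = gradSq u x + c := Real.sq_sqrt (by linarith)
      have hle : Real.sqrt (gradSq u x) ≤ Real.sqrt (gradSq u x + c) :=
        Real.sqrt_le_sqrt (by linarith)
      have hcs : (∑ j, (x j - a j) * pd j u x) ^ 2 ≤ ‖x - a‖ ^ 2 * gradSq u x := by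
        rw [sq_norm_sub_eq_sum]
        exact Finset.sum_mul_sq_le_sq_mul_sq _ _ _
      rw [← sq_norm_sub_eq_sum]
      set Z := ∑ j, (x j - a j) * pd j u x
      set r := ‖x - a‖
      have hr : 0 ≤ r := norm_nonneg _
      have hZ : |Z * (Real.sqrt (gradSq u x + c))⁻¹| ≤ r := by
        rw [abs_mul, abs_inv, abs_of_pos hNpos, ← div_eq_mul_inv, div_le_iff₀ hNpos]
        apply abs_le_of_sq_le_sq _ (by positivity)
        rw [mul_pow, hNsq]
        exact hcs.trans (mul_le_mul_of_nonneg_left (by linarith) (sq_nonneg _))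
      have hq : gradSq u x * (Real.sqrt (gradSq u x + c))⁻¹ ≤ Real.sqrt (gradSq u x + c) := by
        rw [← div_eq_mul_inv, div_le_iff₀ hNpos, ← sq, hNsq]
        linarith
      have hRpos := inv_pos.2 hNpos
      generalize Real.sqrt (gradSq u x + c) = N at *
      generalize hZR : Z * N⁻¹ = w at *
      have e : ∀ s t : ℝ, s * Z * t * N⁻¹ = s * w * t := fun s t => by rw [← hZR]; ring
      have h1 : -(c * (|τ x| * (Φ x * r))) ≤ τ x * Φ x * Z * c * N⁻¹ := by
        rw [e]
        have : |τ x * Φ x * w * c| ≤ |τ x| * Φ x * r * c := by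
          rw [abs_mul, abs_mul, abs_mul, abs_of_nonneg (hΦ0 x), abs_of_pos hc]
          have := hΦ0 x
          gcongr
        linarith [neg_abs_le (τ x * Φ x * w * c)]
      have h2 : θ x * Φ x * Z * N⁻¹ * tangLap c u x ≤ θ x * (Φ x * r) * |tangLap c u x| := by
        have e' : θ x * Φ x * Z * N⁻¹ * tangLap c u x = θ x * Φ x * (w * tangLap c u x) := by
          rw [← hZR]; ring
        rw [e']
        have : w * tangLap c u x ≤ r * |tangLap c u x| := by
          refine (le_abs_self _).trans ?_
          rw [abs_mul]
          gcongr
        nlinarith [mul_le_mul_of_nonneg_left this (mul_nonneg (hθ0 x) (hΦ0 x))]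
      have h3 : Real.sqrt (gradSq u x) * ((n - 1) * Φ x - κ x * r ^ 2) ≤
          -κ x * (N * r ^ 2 - Z ^ 2 * N⁻¹) + Φ x * (n * N - gradSq u x * N⁻¹) := by
        have h4 := mul_le_mul_of_nonneg_right hle (hpos x)
        have h5 : 0 ≤ κ x * (Z ^ 2 * N⁻¹) := by have := hκ0 x; positivity
        have h6 := mul_le_mul_of_nonneg_left hq (hΦ0 x)
        linarith
      have h7 := mul_le_mul_of_nonneg_left h3 (hθ0 x)
      linarith
  have hB : Tendsto (fun c : ℝ => c * ∫ x, |τ x| * (Φ x * ‖x - a‖)) (𝓝[>] 0)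
      (𝓝 (0 * ∫ x, |τ x| * (Φ x * ‖x - a‖))) :=
    ((continuous_id.mul continuous_const).tendsto 0).mono_left nhdsWithin_le_nhds
  have hlim := (tendsto_integral_mul_abs_tangLap hu cw sw).add hB
  rw [zero_mul, add_zero] at hlim
  exact ge_of_tendsto hlim (eventually_nhdsWithin_of_forall fun c hc => key c hc)

end FirstVariation

theorem exists_abs_deriv_smoothTransition_le :
    ∃ L : ℝ, 0 < L ∧ ∀ t, |deriv Real.smoothTransition t| ≤ L := by
  have hc : Continuous (deriv Real.smoothTransition) :=
    (Real.smoothTransition.contDiff (n := 1)).continuous_deriv (by simp)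
  have hs : HasCompactSupport (deriv Real.smoothTransition) := by
    refine HasCompactSupport.intro (isCompact_Icc (a := (0 : ℝ)) (b := 1)) fun t ht => ?_
    rcases not_and_or.1 ht with h | h
    · have : Real.smoothTransition =ᶠ[𝓝 t] fun _ => 0 := by
        filter_upwards [Iio_mem_nhds (not_le.1 h)] with y hy
        exact Real.smoothTransition.zero_of_nonpos (le_of_lt hy)
      rw [this.deriv_eq, deriv_const]
    · have : Real.smoothTransition =ᶠ[𝓝 t] fun _ => 1 := by
        filter_upwards [Ioi_mem_nhds (not_le.1 h)] with y hy
        exact Real.smoothTransition.one_of_one_le (le_of_lt hy)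
      rw [this.deriv_eq, deriv_const]
  obtain ⟨C, hC⟩ := hc.bounded_above_of_compact_support hs
  exact ⟨max C 1, by positivity, fun t => (hC t).trans (le_max_left _ _)⟩

section Rescale

variable {t₀ h : ℝ}

/-- A smooth monotone transition from `0` on `(-∞, t₀]` to `1` on `[t₀ + h, ∞)`. -/
noncomputable def levelStep (t₀ h t : ℝ) : ℝ := Real.smoothTransition ((t - t₀) / h)

theorem contDiff_levelStep : ContDiff ℝ (⊤ : ℕ∞) (levelStep t₀ h) :=
  Real.smoothTransition.contDiff.comp ((contDiff_id.sub contDiff_const).div_const h)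

theorem levelStep_nonneg (t : ℝ) : 0 ≤ levelStep t₀ h t := Real.smoothTransition.nonneg _

theorem levelStep_le_one (t : ℝ) : levelStep t₀ h t ≤ 1 := Real.smoothTransition.le_one _

theorem levelStep_eq_zero (hh : 0 < h) {t : ℝ} (ht : t ≤ t₀) : levelStep t₀ h t = 0 :=
  Real.smoothTransition.zero_of_nonpos
    (div_nonpos_of_nonpos_of_nonneg (by linarith) hh.le)

theorem levelStep_eq_one (hh : 0 < h) {t : ℝ} (ht : t₀ + h ≤ t) : levelStep t₀ h t = 1 :=
  Real.smoothTransition.one_of_one_le ((one_le_div hh).2 (by linarith))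

theorem deriv_levelStep (t : ℝ) :
    deriv (levelStep t₀ h) t = deriv Real.smoothTransition ((t - t₀) / h) / h := by
  have h1 : HasDerivAt (fun t : ℝ => (t - t₀) / h) (1 / h) t :=
    ((hasDerivAt_id t).sub_const t₀).div_const h
  have h2 := (((Real.smoothTransition.contDiff (n := 1)).differentiable
    (by simp)) ((t - t₀) / h)).hasDerivAt
  have h3 : HasDerivAt (levelStep t₀ h) _ t := h2.comp t h1
  rw [h3.deriv, mul_one_div]

theorem deriv_levelStep_nonneg (hh : 0 < h) (t : ℝ) : 0 ≤ deriv (levelStep t₀ h) t := by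
  have : Monotone (levelStep t₀ h) := fun a b hab =>
    Real.smoothTransition.monotone (by gcongr)
  exact this.deriv_nonneg

theorem deriv_levelStep_le {L : ℝ} (hL : ∀ t, |deriv Real.smoothTransition t| ≤ L)
    (hh : 0 < h) (t : ℝ) : deriv (levelStep t₀ h) t ≤ L / h := by
  rw [deriv_levelStep]
  gcongr
  exact (le_abs_self _).trans (hL _)

theorem deriv_levelStep_eq_zero_of_lt (hh : 0 < h) {t : ℝ} (ht : t < t₀) :
    deriv (levelStep t₀ h) t = 0 := by
  have : levelStep t₀ h =ᶠ[𝓝 t] fun _ => 0 := by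
    filter_upwards [Iio_mem_nhds ht] with y hy
    exact levelStep_eq_zero hh (le_of_lt hy)
  rw [this.deriv_eq, deriv_const]

theorem deriv_levelStep_eq_zero_of_le (hh : 0 < h) {t : ℝ} (ht : t₀ + h ≤ t) :
    deriv (levelStep t₀ h) t = 0 := by
  have hz : ∀ y ∈ Set.Ioi (t₀ + h), deriv (levelStep t₀ h) y = 0 := fun y hy => by
    have : levelStep t₀ h =ᶠ[𝓝 y] fun _ => 1 := by
      filter_upwards [Ioi_mem_nhds hy] with z hz
      exact levelStep_eq_one hh (le_of_lt hz)
    rw [this.deriv_eq, deriv_const]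
  have hc : Continuous (deriv (levelStep t₀ h)) :=
    (contDiff_levelStep (t₀ := t₀) (h := h)).continuous_deriv (by simp)
  have hcl := (isClosed_eq hc continuous_const).closure_subset_iff.2 hz
  rw [closure_Ioi] at hcl
  exact hcl ht

end Rescale

section Localization

variable {n : ℕ} {u : EuclideanSpace ℝ (Fin n) → ℝ} {Ω : Set (EuclideanSpace ℝ (Fin n))}
  {φ : ℝ → ℝ} {δ : ℝ}

theorem indicator_comp_eventuallyEq_zero (hu : Continuous u) (hu0 : ∀ x ∈ frontier Ω, u x = 0)
    (hδ : 0 < δ) (hφ : ∀ t < δ, φ t = 0) {x : EuclideanSpace ℝ (Fin n)} (hx : x ∉ Ω) :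
    Ω.indicator (fun y => φ (u y)) =ᶠ[𝓝 x] fun _ => 0 := by
  by_cases hcl : x ∈ closure Ω
  · have hfr : x ∈ frontier Ω := ⟨hcl, fun h => hx (interior_subset h)⟩
    have : ∀ᶠ y in 𝓝 x, u y < δ :=
      hu.continuousAt.eventually_lt continuousAt_const (by rwa [hu0 x hfr])
    filter_upwards [this] with y hy
    by_cases h : y ∈ Ω <;> simp [h, hφ _ hy]
  · filter_upwards [isClosed_closure.isOpen_compl.mem_nhds hcl] with y hy
    exact Set.indicator_of_notMem (fun h => hy (subset_closure h)) _

theorem indicator_comp_eventuallyEq (hΩ : IsOpen Ω) {x : EuclideanSpace ℝ (Fin n)} (hx : x ∈ Ω) :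
    Ω.indicator (fun y => φ (u y)) =ᶠ[𝓝 x] fun y => φ (u y) := by
  filter_upwards [hΩ.mem_nhds hx] with y hy
  exact Set.indicator_of_mem hy _

theorem contDiff_indicator_comp (hu : ContDiff ℝ (⊤ : ℕ∞) u) (hΩ : IsOpen Ω)
    (hu0 : ∀ x ∈ frontier Ω, u x = 0) (hδ : 0 < δ) (hφ : ∀ t < δ, φ t = 0)
    (hφs : ContDiff ℝ (⊤ : ℕ∞) φ) :
    ContDiff ℝ (⊤ : ℕ∞) (Ω.indicator fun y => φ (u y)) := by
  refine contDiff_iff_contDiffAt.2 fun x => ?_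
  by_cases hx : x ∈ Ω
  · exact (hφs.comp hu).contDiffAt.congr_of_eventuallyEq (indicator_comp_eventuallyEq hΩ hx)
  · exact contDiffAt_const.congr_of_eventuallyEq
      (indicator_comp_eventuallyEq_zero hu.continuous hu0 hδ hφ hx)

theorem tsupport_indicator_comp_subset (hu : Continuous u)
    (hu0 : ∀ x ∈ frontier Ω, u x = 0) (hδ : 0 < δ) (hφ : ∀ t < δ, φ t = 0) :
    tsupport (Ω.indicator fun y => φ (u y)) ⊆ Ω := fun _ hx => by
  by_contra h
  exact notMem_tsupport_iff_eventuallyEq.2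
    (indicator_comp_eventuallyEq_zero hu hu0 hδ hφ h) hx

theorem hasCompactSupport_indicator_comp (hΩb : IsBounded Ω) :
    HasCompactSupport (Ω.indicator fun y => φ (u y)) :=
  Metric.isCompact_of_isClosed_isBounded isClosed_closure
    (hΩb.subset Set.support_indicator_subset).closure

theorem pd_indicator_comp (hu : ContDiff ℝ (⊤ : ℕ∞) u) (hΩ : IsOpen Ω)
    (hu0 : ∀ x ∈ frontier Ω, u x = 0) (hδ : 0 < δ) (hφ : ∀ t < δ, φ t = 0)
    (hφs : ContDiff ℝ (⊤ : ℕ∞) φ) (i : Fin n) (x : EuclideanSpace ℝ (Fin n)) :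
    pd i (Ω.indicator fun y => φ (u y)) x =
      Ω.indicator (fun y => deriv φ (u y)) x * pd i u x := by
  by_cases hx : x ∈ Ω
  · rw [pd_congr (indicator_comp_eventuallyEq hΩ hx), Set.indicator_of_mem hx]
    exact pd_comp (hφs.differentiable (by simp) _).hasDerivAt (hu.differentiable (by simp) x) i
  · rw [pd_congr (indicator_comp_eventuallyEq_zero hu.continuous hu0 hδ hφ hx),
      Set.indicator_of_notMem hx]
    simp [pd]

end Localization

theorem Continuous.integrableOn_of_isBounded {n : ℕ} {f : EuclideanSpace ℝ (Fin n) → ℝ}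
    {S : Set (EuclideanSpace ℝ (Fin n))} (hf : Continuous f) (hS : IsBounded S) :
    IntegrableOn f S :=
  (hf.continuousOn.integrableOn_compact (K := closure S)
    (Metric.isCompact_of_isClosed_isBounded isClosed_closure hS.closure)).mono_set subset_closure

theorem setIntegral_tangHess_le {n : ℕ} {u : EuclideanSpace ℝ (Fin n) → ℝ}
    {Ω : Set (EuclideanSpace ℝ (Fin n))} {g : ℝ → ℝ} {L s : ℝ}
    (hL : ∀ t, |deriv Real.smoothTransition t| ≤ L) (hΩ : IsOpen Ω) (hΩb : IsBounded Ω)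
    (hg : ContDiff ℝ (⊤ : ℕ∞) g) (hu : ContDiff ℝ (⊤ : ℕ∞) u)
    (heq : ∀ x ∈ Ω, -lap u x = g (u x)) (hu0 : ∀ x ∈ frontier Ω, u x = 0)
    (hst : SemiStable Ω g u) (hs : 0 < s) :
    IntegrableOn (tangHess 0 u) (Ω ∩ {x | s ≤ u x}) ∧
    ∫ x in Ω ∩ {x | s ≤ u x}, tangHess 0 u x ≤
      (2 * L / s) ^ 2 * ∫ x in Ω ∩ {x | |u x| ≤ s}, ‖gradient u x‖ ^ 4 := by
  have hs2 : 0 < s / 2 := by positivity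
  have hφ : ∀ t < s / 2, levelStep (s / 2) (s / 2) t = 0 := fun t ht =>
    levelStep_eq_zero hs2 ht.le
  set θ : EuclideanSpace ℝ (Fin n) → ℝ :=
    Ω.indicator fun y => levelStep (s / 2) (s / 2) (u y) with hθ
  have hθs : ContDiff ℝ (⊤ : ℕ∞) θ :=
    contDiff_indicator_comp hu hΩ hu0 hs2 hφ contDiff_levelStep
  have hθc : HasCompactSupport θ := hasCompactSupport_indicator_comp hΩb
  have key := integral_sq_mul_tangHess_le hu hg hΩ heq hst hθs hθc
    (tsupport_indicator_comp_subset hu.continuous hu0 hs2 hφ)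
  have hi := integrable_sq_mul_tangHess hu hθs hθc (le_refl (0 : ℝ))
  have hm : MeasurableSet (Ω ∩ {x | s ≤ u x}) :=
    hΩ.measurableSet.inter (measurableSet_le measurable_const hu.continuous.measurable)
  have hm' : MeasurableSet (Ω ∩ {x | |u x| ≤ s}) :=
    hΩ.measurableSet.inter (measurableSet_le hu.continuous.abs.measurable measurable_const)
  have hone : Set.EqOn (fun x => θ x ^ 2 * tangHess 0 u x) (tangHess 0 u)
      (Ω ∩ {x | s ≤ u x}) := fun x hx => by
    have h1 : θ x = 1 := by
      rw [hθ, Set.indicator_of_mem hx.1]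
      exact levelStep_eq_one hs2 (by linarith [show s ≤ u x from hx.2])
    simp [h1]
  refine ⟨hi.integrableOn.congr_fun hone hm, ?_⟩
  rw [← setIntegral_congr_fun hm hone]
  refine (setIntegral_le_integral hi (Eventually.of_forall fun x =>
    mul_nonneg (sq_nonneg _) (tangHess_nonneg le_rfl x))).trans (key.trans ?_)
  have h4 : ∀ x, ‖gradient u x‖ ^ 4 = gradSq u x ^ 2 := fun x => by
    rw [gradSq, ← norm_gradient_sq]; ring
  simp only [h4]
  rw [← integral_const_mul, ← integral_indicator hm']
  have cq := (contDiff_gradSq hu).continuous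
  refine integral_mono ?_ ?_ fun x => ?_
  · have hsc : ∀ i, HasCompactSupport (pd i θ) := fun i => hθc.fderiv_apply ℝ _
    simp only [Finset.mul_sum]
    refine integrable_finsetSum _ fun i _ => ?_
    refine Continuous.integrable_of_hasCompactSupport
      (cq.mul ((hθs.pd i).continuous.pow 2)) ?_
    refine HasCompactSupport.mono (hsc i) fun x hx => ?_
    simp only [Function.mem_support, ne_eq, mul_eq_zero, not_or] at hx ⊢
    exact fun h => hx.2 (by rw [h]; ring)
  · refine (integrable_indicator_iff hm').2 ?_
    exact ((continuous_const.mul (cq.pow 2))).integrableOn_of_isBounded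
      (hΩb.subset Set.inter_subset_left)
  · have hpd : ∀ i, pd i θ x =
        Ω.indicator (fun y => deriv (levelStep (s / 2) (s / 2)) (u y)) x * pd i u x := fun i =>
      pd_indicator_comp hu hΩ hu0 hs2 hφ contDiff_levelStep i x
    have e : gradSq u x * ∑ i, pd i θ x ^ 2 =
        Ω.indicator (fun y => deriv (levelStep (s / 2) (s / 2)) (u y)) x ^ 2 * gradSq u x ^ 2 := by
      simp only [hpd, mul_pow, ← Finset.mul_sum]
      rw [← gradSq]; ring
    simp only [e]
    have hnn : 0 ≤ (2 * L / s) ^ 2 * gradSq u x ^ 2 := by positivity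
    by_cases hx : x ∈ Ω
    · rw [Set.indicator_of_mem hx]
      by_cases hx2 : |u x| ≤ s
      · rw [Set.indicator_of_mem (show x ∈ Ω ∩ {y | |u y| ≤ s} from ⟨hx, hx2⟩)]
        have h1 := deriv_levelStep_le (t₀ := s / 2) hL hs2 (u x)
        have h2 := deriv_levelStep_nonneg (t₀ := s / 2) hs2 (u x)
        have h3 : L / (s / 2) = 2 * L / s := by field_simp
        rw [h3] at h1
        gcongr
      · have hz : deriv (levelStep (s / 2) (s / 2)) (u x) = 0 := by
          rcases lt_abs.1 (not_le.1 hx2) with h | h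
          · exact deriv_levelStep_eq_zero_of_le hs2 (by linarith)
          · exact deriv_levelStep_eq_zero_of_lt hs2 (by linarith)
        rw [hz]
        simp only [ne_eq, OfNat.ofNat_ne_zero, not_false_eq_true, zero_pow, zero_mul]
        exact Set.indicator_nonneg (fun y _ => by positivity) x
    · rw [Set.indicator_of_notMem hx]
      simp only [ne_eq, OfNat.ofNat_ne_zero, not_false_eq_true, zero_pow, zero_mul]
      exact Set.indicator_nonneg (fun y _ => by positivity) x

/-- A functional form of the isoperimetric inequality. -/
theorem exists_measureReal_rpow_le_integral_norm_fderiv {n : ℕ} (hn : 2 ≤ n) :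
    ∃ K : ℝ, 0 < K ∧ ∀ v : EuclideanSpace ℝ (Fin n) → ℝ, ContDiff ℝ 1 v → HasCompactSupport v →
      ∀ A : Set (EuclideanSpace ℝ (Fin n)), MeasurableSet A → (∀ x ∈ A, 1 ≤ ‖v x‖) →
        volume.real A ^ (((n : ℝ) - 1) / n) ≤ K * ∫ x, ‖fderiv ℝ v x‖ := by
  have hn1 : (1 : ℝ) < n := by exact_mod_cast hn
  have hn0 : (0 : ℝ) < n := by linarith
  have hq : 0 < ((n : ℝ) - 1) / n := div_pos (by linarith) hn0
  set p : ℝ := n / (n - 1) with hp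
  have hp0 : 0 < p := div_pos hn0 (by linarith)
  have hpq : p * (((n : ℝ) - 1) / n) = 1 := by
    rw [hp]; field_simp
    exact div_self (by linarith)
  have hconj : Real.HolderConjugate (Module.finrank ℝ (EuclideanSpace ℝ (Fin n)) : ℝ) p := by
    rw [finrank_euclideanSpace_fin]
    exact Real.HolderConjugate.conjExponent hn1
  set C : ℝ := ((lintegralPowLePowLIntegralFDerivConst
    (volume : Measure (EuclideanSpace ℝ (Fin n))) p : NNReal) : ℝ) with hC
  have hC0 : 0 ≤ C := NNReal.coe_nonneg _
  refine ⟨(C + 1) ^ (((n : ℝ) - 1) / n), by positivity, fun v hv hvc A hA hA1 => ?_⟩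
  have hi : Integrable fun x => ‖fderiv ℝ v x‖ :=
    ((hv.continuous_fderiv (by simp)).integrable_of_hasCompactSupport (hvc.fderiv ℝ)).norm
  have hI0 : 0 ≤ ∫ x, ‖fderiv ℝ v x‖ := integral_nonneg fun _ => norm_nonneg _
  have h1 : volume A ≤ ∫⁻ x, ‖v x‖ₑ ^ p := by
    calc volume A = ∫⁻ x in A, 1 := by simp
      _ ≤ ∫⁻ x in A, ‖v x‖ₑ ^ p := by
        refine setLIntegral_mono' hA fun x hx => ?_
        have : (1 : ℝ≥0∞) ≤ ‖v x‖ₑ := by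
          rw [← ofReal_norm, ENNReal.one_le_ofReal]
          exact hA1 x hx
        exact ENNReal.one_le_rpow this hp0
      _ ≤ _ := setLIntegral_le_lintegral _ _
  have h2 := h1.trans (lintegral_pow_le_pow_lintegral_fderiv volume hv hvc hconj)
  have h3 : ∫⁻ x, ‖fderiv ℝ v x‖ₑ = ENNReal.ofReal (∫ x, ‖fderiv ℝ v x‖) := by
    rw [ofReal_integral_eq_lintegral_ofReal hi (Eventually.of_forall fun _ => norm_nonneg _)]
    simp only [ofReal_norm]
  rw [h3, ENNReal.ofReal_rpow_of_nonneg hI0 hp0.le] at h2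
  have h4 : volume.real A ≤ C * (∫ x, ‖fderiv ℝ v x‖) ^ p := by
    have := ENNReal.toReal_mono (by finiteness) h2
    rwa [ENNReal.toReal_mul, ENNReal.toReal_ofReal (by positivity)] at this
  calc volume.real A ^ (((n : ℝ) - 1) / n)
      ≤ ((C + 1) * (∫ x, ‖fderiv ℝ v x‖) ^ p) ^ (((n : ℝ) - 1) / n) := by
        refine Real.rpow_le_rpow measureReal_nonneg (h4.trans ?_) hq.le
        have : 0 ≤ (∫ x, ‖fderiv ℝ v x‖) ^ p := by positivity
        nlinarith
    _ = _ := by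
        rw [Real.mul_rpow (by positivity) (by positivity), ← Real.rpow_mul hI0, hpq,
          Real.rpow_one]

theorem norm_fderiv_levelStep_norm_sq_le {n : ℕ} {L ρ : ℝ}
    (hL : ∀ t, |deriv Real.smoothTransition t| ≤ L) (hρ : 0 < ρ)
    (a x : EuclideanSpace ℝ (Fin n)) :
    ‖fderiv ℝ (fun y => 1 - levelStep (ρ ^ 2) (ρ ^ 2) (‖y - a‖ ^ 2)) x‖ ≤
      L / ρ ^ 2 * (2 * ‖x - a‖) := by
  have hρ2 : 0 < ρ ^ 2 := by positivity
  have h1 : HasFDerivAt (fun y => ‖y - a‖ ^ 2) _ x := ((hasFDerivAt_id x).sub_const a).norm_sq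
  have h2 := (contDiff_levelStep (t₀ := ρ ^ 2) (h := ρ ^ 2)).differentiable (by simp)
    (‖x - a‖ ^ 2) |>.hasDerivAt
  have h3 := ((h2.comp_hasFDerivAt (f := fun y => ‖y - a‖ ^ 2) x h1).const_sub 1).fderiv
  simp only [Function.comp_apply] at h3
  rw [h3, norm_neg, norm_smul, Real.norm_eq_abs,
    abs_of_nonneg (deriv_levelStep_nonneg hρ2 _)]
  have h4 := deriv_levelStep_le (t₀ := ρ ^ 2) hL hρ2 (‖x - a‖ ^ 2)
  refine mul_le_mul h4 ?_ (norm_nonneg _) ((deriv_levelStep_nonneg hρ2 _).trans h4)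
  refine (norm_nsmul_le).trans ?_
  push_cast
  gcongr
  refine (ContinuousLinearMap.opNorm_comp_le _ _).trans ?_
  rw [innerSL_apply_norm]
  exact mul_le_of_le_one_right (norm_nonneg _) ContinuousLinearMap.norm_id_le

/-- A relative isoperimetric inequality for functions whose support has small density in a ball. -/
theorem exists_le_setIntegral_norm_fderiv {n : ℕ} (hn : 2 ≤ n) :
    ∃ c σ : ℝ, 0 < c ∧ 0 < σ ∧ σ ≤ 1 ∧
      ∀ f : EuclideanSpace ℝ (Fin n) → ℝ, ContDiff ℝ 1 f → HasCompactSupport f →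
        (∀ x, 0 ≤ f x) → (∀ x, f x ≤ 1) → ∀ (a : EuclideanSpace ℝ (Fin n)) (ρ : ℝ), 0 < ρ →
          σ / 2 * volume.real (Metric.ball a ρ) ≤ volume.real ({x | f x = 1} ∩ Metric.ball a ρ) →
          volume.real ({x | f x ≠ 0} ∩ Metric.ball a (2 * ρ)) ≤
            σ * volume.real (Metric.ball a (2 * ρ)) →
          c * ρ ^ (n - 1) ≤ ∫ x in Metric.ball a (2 * ρ), ‖fderiv ℝ f x‖ := by
  obtain ⟨K, hK, hiso⟩ := exists_measureReal_rpow_le_integral_norm_fderiv hn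
  obtain ⟨L, hL0, hL⟩ := exists_abs_deriv_smoothTransition_le
  have hn1 : (1 : ℝ) < n := by exact_mod_cast hn
  have hn0 : (0 : ℝ) < n := by linarith
  set q : ℝ := ((n : ℝ) - 1) / n with hq
  have hq0 : 0 < q := div_pos (by linarith) hn0
  set β := volume.real (Metric.ball (0 : EuclideanSpace ℝ (Fin n)) 1) with hβ
  have hβ0 : 0 < β := ENNReal.toReal_pos (Metric.measure_ball_pos _ _ one_pos).ne'
    measure_ball_lt_top.ne
  have hball : ∀ (a : EuclideanSpace ℝ (Fin n)) (ρ : ℝ), 0 < ρ →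
      volume.real (Metric.ball a ρ) = ρ ^ n * β := fun a ρ hρ => by
    rw [measureReal_def, Measure.addHaar_ball_of_pos _ _ hρ, ENNReal.toReal_mul,
      ENNReal.toReal_ofReal (by positivity), finrank_euclideanSpace_fin, hβ, measureReal_def]
  set κ : ℝ := (β / 2) ^ q / (2 * (K * (4 * L * 2 ^ n * β))) with hκ
  have hκ0 : 0 < κ := by positivity
  set σ : ℝ := min 1 (κ ^ n) with hσ
  have hσ0 : 0 < σ := lt_min one_pos (by positivity)
  have hσκ : σ ^ (1 / (n : ℝ)) ≤ κ := by
    calc σ ^ (1 / (n : ℝ)) ≤ (κ ^ n) ^ (1 / (n : ℝ)) :=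
          Real.rpow_le_rpow hσ0.le (min_le_right _ _) (by positivity)
      _ = κ := by rw [one_div]; exact Real.pow_rpow_inv_natCast hκ0.le (by omega)
  have hσq : K * (4 * L * 2 ^ n * β * σ) ≤ (σ / 2 * β) ^ q / 2 := by
    have e1 : σ = σ ^ (1 / (n : ℝ)) * σ ^ q := by
      rw [← Real.rpow_add hσ0, hq, ← add_div]
      rw [show (1 + ((n : ℝ) - 1)) / n = 1 by field_simp; ring, Real.rpow_one]
    have e2 : (σ / 2 * β) ^ q = σ ^ q * (β / 2) ^ q := by
      rw [← Real.mul_rpow hσ0.le (by positivity)]; ring_nf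
    have e3 : K * (4 * L * 2 ^ n * β) * κ = (β / 2) ^ q / 2 := by
      rw [hκ]; field_simp
    calc K * (4 * L * 2 ^ n * β * σ)
        = K * (4 * L * 2 ^ n * β) * σ ^ (1 / (n : ℝ)) * σ ^ q := by
          conv_lhs => rw [e1]
          ring
      _ ≤ K * (4 * L * 2 ^ n * β) * κ * σ ^ q := by gcongr
      _ = _ := by rw [e3, e2]; ring
  refine ⟨(σ / 2 * β) ^ q / (2 * K), σ, by positivity, hσ0, min_le_left _ _,
    fun f hf hfc hf0 hf1 a ρ hρ h1 h2 => ?_⟩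
  have hρ2 : 0 < ρ ^ 2 := by positivity
  set χ : EuclideanSpace ℝ (Fin n) → ℝ :=
    fun y => 1 - levelStep (ρ ^ 2) (ρ ^ 2) (‖y - a‖ ^ 2) with hχ
  have hχs : ContDiff ℝ (⊤ : ℕ∞) χ := contDiff_const.sub
    (contDiff_levelStep.comp ((contDiff_id.sub contDiff_const).norm_sq ℝ))
  have hχs1 : ContDiff ℝ 1 χ := hχs.of_le (by exact_mod_cast le_top)
  have hχ0 : ∀ x, 0 ≤ χ x := fun x => sub_nonneg.2 (levelStep_le_one _)
  have hχ1 : ∀ x, χ x ≤ 1 := fun x => by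
    have := levelStep_nonneg (t₀ := ρ ^ 2) (h := ρ ^ 2) (‖x - a‖ ^ 2)
    simp only [hχ]; linarith
  have hχz : ∀ x ∉ Metric.ball a (2 * ρ), χ =ᶠ[𝓝 x] fun _ => 0 := fun x hx => by
    rw [Metric.mem_ball, dist_eq_norm, not_lt] at hx
    have hlt : ρ ^ 2 + ρ ^ 2 < ‖x - a‖ ^ 2 := by nlinarith
    have hev : ∀ᶠ y in 𝓝 x, ρ ^ 2 + ρ ^ 2 < ‖y - a‖ ^ 2 :=
      continuousAt_const.eventually_lt (by fun_prop) hlt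
    filter_upwards [hev] with y hy
    simp [hχ, levelStep_eq_one hρ2 hy.le]
  have hvs : ContDiff ℝ 1 fun x => f x * χ x := hf.mul hχs1
  have hvc : HasCompactSupport fun x => f x * χ x := hfc.mul_right
  have hcf : Continuous (fderiv ℝ f) := hf.continuous_fderiv (by simp)
  have hAm : MeasurableSet ({x | f x = 1} ∩ Metric.ball a ρ) :=
    (measurableSet_eq_fun hf.continuous.measurable measurable_const).inter measurableSet_ball
  have hSm : MeasurableSet ({x | f x ≠ 0} ∩ Metric.ball a (2 * ρ)) :=
    ((measurableSet_eq_fun hf.continuous.measurable measurable_const).compl).inter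
      measurableSet_ball
  have hi := hiso _ hvs hvc _ hAm fun x hx => by
    have hxρ : ‖x - a‖ < ρ := by simpa [dist_eq_norm] using hx.2
    have : χ x = 1 := by
      simp only [hχ]
      rw [levelStep_eq_zero hρ2 (by gcongr), sub_zero]
    have hfx : f x = 1 := hx.1
    simp [this, hfx]
  have hpt : ∀ x, ‖fderiv ℝ (fun x => f x * χ x) x‖ ≤
      (Metric.ball a (2 * ρ)).indicator (fun y => ‖fderiv ℝ f y‖) x
        + ({x | f x ≠ 0} ∩ Metric.ball a (2 * ρ)).indicator (fun _ => 4 * L / ρ) x := by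
    intro x
    by_cases hx : x ∈ Metric.ball a (2 * ρ)
    · rw [Set.indicator_of_mem hx,
        fderiv_fun_mul (hf.differentiable (by simp) x) (hχs1.differentiable (by simp) x)]
      refine (norm_add_le _ _).trans ?_
      rw [norm_smul, norm_smul, Real.norm_of_nonneg (hχ0 x), Real.norm_of_nonneg (hf0 x), add_comm]
      refine add_le_add (mul_le_of_le_one_left (norm_nonneg _) (hχ1 x)) ?_
      by_cases hfx : f x = 0
      · rw [hfx, zero_mul]
        exact Set.indicator_nonneg (fun _ _ => by positivity) x
      · rw [Set.indicator_of_mem (show x ∈ {x | f x ≠ 0} ∩ Metric.ball a (2 * ρ) from ⟨hfx, hx⟩)]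
        refine (mul_le_of_le_one_left (norm_nonneg _) (hf1 x)).trans
          ((norm_fderiv_levelStep_norm_sq_le hL hρ a x).trans ?_)
        rw [Metric.mem_ball, dist_eq_norm] at hx
        calc L / ρ ^ 2 * (2 * ‖x - a‖) ≤ L / ρ ^ 2 * (2 * (2 * ρ)) := by gcongr
          _ = 4 * L / ρ := by field_simp; ring
    · have hz : (fun x => f x * χ x) =ᶠ[𝓝 x] fun _ => 0 := by
        filter_upwards [hχz x hx] with y hy
        rw [hy, mul_zero]
      rw [hz.fderiv_eq]
      simp [hx]
  have hif : IntegrableOn (fun y => ‖fderiv ℝ f y‖) (Metric.ball a (2 * ρ)) :=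
    ((hcf.integrable_of_hasCompactSupport (hfc.fderiv ℝ)).norm).integrableOn
  have hi1 := (integrable_indicator_iff measurableSet_ball).2 hif
  have hfin : volume ({x | f x ≠ 0} ∩ Metric.ball a (2 * ρ)) ≠ ⊤ :=
    (measure_mono Set.inter_subset_right |>.trans_lt measure_ball_lt_top).ne
  have hi2 : Integrable (({x | f x ≠ 0} ∩ Metric.ball a (2 * ρ)).indicator
      (fun _ => 4 * L / ρ)) :=
    (integrable_indicator_iff hSm).2 (integrableOn_const hfin)
  have hwint := integral_mono
    ((hvs.continuous_fderiv (by simp)).integrable_of_hasCompactSupport (hvc.fderiv ℝ)).norm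
    (hi1.add hi2) hpt
  rw [integral_add' hi1 hi2, integral_indicator measurableSet_ball, integral_indicator hSm,
    setIntegral_const, smul_eq_mul] at hwint
  set I := ∫ x in Metric.ball a (2 * ρ), ‖fderiv ℝ f x‖
  rw [hball _ _ hρ] at h1
  rw [hball _ _ (by positivity)] at h2
  have hρn : ρ ^ n = ρ ^ (n - 1) * ρ := by rw [← pow_succ]; congr 1; omega
  have h3 : (σ / 2 * β) ^ q * ρ ^ (n - 1) ≤
      volume.real ({x | f x = 1} ∩ Metric.ball a ρ) ^ q := by
    have : (σ / 2 * β) ^ q * ρ ^ (n - 1) = (σ / 2 * (ρ ^ n * β)) ^ q := by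
      rw [show σ / 2 * (ρ ^ n * β) = (σ / 2 * β) * ρ ^ n by ring,
        Real.mul_rpow (x := σ / 2 * β) (by positivity) (by positivity)]
      congr 1
      rw [← Real.rpow_natCast ρ n, ← Real.rpow_mul hρ.le, hq, mul_div_cancel₀ _ hn0.ne',
        ← Real.rpow_natCast, Nat.cast_sub (by omega), Nat.cast_one]
    rw [this]
    exact Real.rpow_le_rpow (by positivity) h1 hq0.le
  have h4 : volume.real ({x | f x ≠ 0} ∩ Metric.ball a (2 * ρ)) * (4 * L / ρ) ≤
      4 * L * 2 ^ n * β * σ * ρ ^ (n - 1) := by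
    calc _ ≤ σ * ((2 * ρ) ^ n * β) * (4 * L / ρ) := by gcongr
      _ = _ := by rw [mul_pow, hρn]; field_simp
  have h5 : (σ / 2 * β) ^ q * ρ ^ (n - 1) ≤ K * (I + 4 * L * 2 ^ n * β * σ * ρ ^ (n - 1)) :=
    h3.trans (hi.trans (mul_le_mul_of_nonneg_left (hwint.trans (by linarith)) hK.le))
  have h6 := mul_le_mul_of_nonneg_right hσq (show 0 ≤ ρ ^ (n - 1) by positivity)
  have h7 : (σ / 2 * β) ^ q / 2 * ρ ^ (n - 1) ≤ K * I := by linarith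
  rw [div_mul_eq_mul_div, div_le_iff₀ (by positivity)]
  linarith

section RadialWeight

variable {n : ℕ} {a : EuclideanSpace ℝ (Fin n)} {ρ : ℝ}

theorem contDiff_norm_sq_add_rpow (hρ : 0 < ρ) (p : ℝ) :
    ContDiff ℝ (⊤ : ℕ∞) fun y : EuclideanSpace ℝ (Fin n) => (‖y - a‖ ^ 2 + ρ ^ 2) ^ p :=
  (((contDiff_id.sub contDiff_const).norm_sq ℝ).add contDiff_const).rpow_const_of_ne fun x => by
    positivity

theorem pd_norm_sq_add_rpow (hρ : 0 < ρ) (p : ℝ) (i : Fin n) (x : EuclideanSpace ℝ (Fin n)) :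
    pd i (fun y => (‖y - a‖ ^ 2 + ρ ^ 2) ^ p) x =
      2 * p * (‖x - a‖ ^ 2 + ρ ^ 2) ^ (p - 1) * (x i - a i) := by
  have hpos : 0 < ‖x - a‖ ^ 2 + ρ ^ 2 := by positivity
  have h1 : HasDerivAt (fun t : ℝ => (t + ρ ^ 2) ^ p)
      (1 * p * (‖x - a‖ ^ 2 + ρ ^ 2) ^ (p - 1)) (‖x - a‖ ^ 2) :=
    ((hasDerivAt_id _).add_const _).rpow_const (Or.inl hpos.ne')
  have h2 : HasFDerivAt (fun y => ‖y - a‖ ^ 2) _ x := ((hasFDerivAt_id x).sub_const a).norm_sq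
  rw [pd_comp (f := fun y => ‖y - a‖ ^ 2) h1 h2.differentiableAt i]
  have h3 : pd i (fun y => ‖y - a‖ ^ 2) x = 2 * (x i - a i) := by
    unfold pd
    rw [h2.fderiv]
    simp [EuclideanSpace.inner_single_right]
  rw [h3]; ring

theorem rpow_mul_norm_sub_le (hn : 2 ≤ n) (x : EuclideanSpace ℝ (Fin n)) :
    (‖x - a‖ ^ 2 + ρ ^ 2) ^ (-((n : ℝ) - 1) / 2) * ‖x - a‖ ≤ (‖x - a‖ ^ (n - 2))⁻¹ := by
  rcases (norm_nonneg (x - a)).eq_or_lt with h0 | h0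
  · rw [← h0]; simp only [mul_zero]; positivity
  · have hn' : (2 : ℝ) ≤ n := by exact_mod_cast hn
    have h1 : (‖x - a‖ ^ 2 + ρ ^ 2) ^ (-((n : ℝ) - 1) / 2) ≤
        (‖x - a‖ ^ 2) ^ (-((n : ℝ) - 1) / 2) :=
      Real.rpow_le_rpow_of_nonpos (by positivity) (by nlinarith) (by linarith)
    have h2 : (‖x - a‖ ^ 2) ^ (-((n : ℝ) - 1) / 2) * ‖x - a‖ = (‖x - a‖ ^ (n - 2))⁻¹ := by
      rw [← Real.rpow_natCast ‖x - a‖ 2, ← Real.rpow_mul h0.le]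
      nth_rewrite 2 [← Real.rpow_one ‖x - a‖]
      rw [← Real.rpow_add h0, ← Real.rpow_natCast, ← Real.rpow_neg h0.le, Nat.cast_sub hn]
      congr 1; push_cast; ring
    exact (mul_le_mul_of_nonneg_right h1 h0.le).trans h2.le

theorem le_rpow_mul_sq_of_mem_ball (hn : 2 ≤ n) (hρ : 0 < ρ) {x : EuclideanSpace ℝ (Fin n)}
    (hx : x ∈ Metric.ball a (2 * ρ)) :
    (5 : ℝ) ^ (-((n : ℝ) - 1) / 2 - 1) * (ρ ^ (n - 1))⁻¹ ≤
      (‖x - a‖ ^ 2 + ρ ^ 2) ^ (-((n : ℝ) - 1) / 2 - 1) * ρ ^ 2 := by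
  have hn' : (2 : ℝ) ≤ n := by exact_mod_cast hn
  rw [Metric.mem_ball, dist_eq_norm] at hx
  have h1 : (5 * ρ ^ 2) ^ (-((n : ℝ) - 1) / 2 - 1) ≤
      (‖x - a‖ ^ 2 + ρ ^ 2) ^ (-((n : ℝ) - 1) / 2 - 1) :=
    Real.rpow_le_rpow_of_nonpos (by positivity) (by nlinarith [norm_nonneg (x - a)])
      (by linarith)
  have h2 : (5 * ρ ^ 2) ^ (-((n : ℝ) - 1) / 2 - 1) * ρ ^ 2 =
      (5 : ℝ) ^ (-((n : ℝ) - 1) / 2 - 1) * (ρ ^ (n - 1))⁻¹ := by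
    rw [Real.mul_rpow (by norm_num) (by positivity), mul_assoc]
    congr 1
    rw [← Real.rpow_natCast ρ 2, ← Real.rpow_mul hρ.le, ← Real.rpow_add hρ,
      ← Real.rpow_natCast, ← Real.rpow_neg hρ.le, Nat.cast_sub (by omega)]
    congr 1; push_cast; ring
  rw [← h2]
  gcongr

end RadialWeight

theorem deriv_eq_zero_of_forall_lt {φ : ℝ → ℝ} {δ : ℝ} (hφ : ∀ t < δ, φ t = 0) :
    ∀ t < δ, deriv φ t = 0 := fun t ht => by
  have : φ =ᶠ[𝓝 t] fun _ => 0 := by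
    filter_upwards [Iio_mem_nhds ht] with y hy using hφ y hy
  rw [this.deriv_eq, deriv_const]

theorem exists_mul_le_setIntegral_of_density {n : ℕ} (hn : 2 ≤ n) :
    ∃ c σ : ℝ, 0 < c ∧ 0 < σ ∧ σ ≤ 1 ∧
      ∀ (u : EuclideanSpace ℝ (Fin n) → ℝ) (Ω : Set (EuclideanSpace ℝ (Fin n))),
        ContDiff ℝ (⊤ : ℕ∞) u → IsOpen Ω → IsBounded Ω → (∀ x ∈ frontier Ω, u x = 0) →
        ∀ (a : EuclideanSpace ℝ (Fin n)) (ρ t₀ h : ℝ), 0 < ρ → 0 < t₀ → 0 < h →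
          IntegrableOn (fun x => (‖x - a‖ ^ (n - 2))⁻¹ * |tangLap 0 u x|) Ω →
          σ / 2 * volume.real (Metric.ball a ρ) ≤
            volume.real ((Ω ∩ {x | t₀ + h ≤ u x}) ∩ Metric.ball a ρ) →
          volume.real ((Ω ∩ {x | t₀ < u x}) ∩ Metric.ball a (2 * ρ)) ≤
            σ * volume.real (Metric.ball a (2 * ρ)) →
          c * h ≤ ∫ x in Ω ∩ {x | t₀ ≤ u x ∧ u x < t₀ + h},
            (‖x - a‖ ^ (n - 2))⁻¹ * |tangLap 0 u x| := by
  obtain ⟨c, σ, hc, hσ, hσ1, hiso⟩ := exists_le_setIntegral_norm_fderiv hn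
  obtain ⟨L, hL0, hL⟩ := exists_abs_deriv_smoothTransition_le
  have hn' : (2 : ℝ) ≤ n := by exact_mod_cast hn
  have hn1 : (0 : ℝ) < n - 1 := by linarith
  set p : ℝ := -((n : ℝ) - 1) / 2 with hp
  refine ⟨c * ((n - 1) * 5 ^ (p - 1)) / L, σ, by positivity, hσ, hσ1,
    fun u Ω hu hΩ hΩb hu0 a ρ t₀ h hρ ht₀ hh hwint h1 h2 => ?_⟩
  set φ := levelStep t₀ h with hφdef
  have hφs : ContDiff ℝ (⊤ : ℕ∞) φ := contDiff_levelStep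
  have hφs' : ContDiff ℝ (⊤ : ℕ∞) (deriv φ) := (contDiff_infty_iff_deriv.1 hφs).2
  have hφs'' : ContDiff ℝ (⊤ : ℕ∞) (deriv (deriv φ)) := (contDiff_infty_iff_deriv.1 hφs').2
  have hφ0 : ∀ t < t₀, φ t = 0 := fun t ht => levelStep_eq_zero hh ht.le
  have hφ0' := deriv_eq_zero_of_forall_lt hφ0
  have hφ0'' := deriv_eq_zero_of_forall_lt hφ0'
  set f : EuclideanSpace ℝ (Fin n) → ℝ := Ω.indicator fun y => φ (u y) with hf
  set θ : EuclideanSpace ℝ (Fin n) → ℝ := Ω.indicator fun y => deriv φ (u y) with hθ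
  set τ : EuclideanSpace ℝ (Fin n) → ℝ := Ω.indicator fun y => deriv (deriv φ) (u y) with hτ
  have hfs : ContDiff ℝ (⊤ : ℕ∞) f := contDiff_indicator_comp hu hΩ hu0 ht₀ hφ0 hφs
  have hθs : ContDiff ℝ (⊤ : ℕ∞) θ := contDiff_indicator_comp hu hΩ hu0 ht₀ hφ0' hφs'
  have hτs : ContDiff ℝ (⊤ : ℕ∞) τ := contDiff_indicator_comp hu hΩ hu0 ht₀ hφ0'' hφs''
  have hfc : HasCompactSupport f := hasCompactSupport_indicator_comp hΩb
  have hθc : HasCompactSupport θ := hasCompactSupport_indicator_comp hΩb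
  have hθ0 : ∀ x, 0 ≤ θ x := fun x =>
    Set.indicator_nonneg (fun y _ => deriv_levelStep_nonneg hh (u y)) x
  have hDf : ∀ x, ‖fderiv ℝ f x‖ = θ x * Real.sqrt (gradSq u x) := fun x => by
    rw [← Real.sqrt_sq (norm_nonneg (fderiv ℝ f x)), norm_fderiv_sq,
      ← Real.sqrt_sq (hθ0 x), ← Real.sqrt_mul (sq_nonneg _)]
    congr 1
    rw [gradSq, Finset.mul_sum]
    refine Finset.sum_congr rfl fun i _ => ?_
    rw [hf, pd_indicator_comp hu hΩ hu0 ht₀ hφ0 hφs, mul_pow]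
  have hI := hiso f (hfs.of_le (by exact_mod_cast le_top)) hfc
    (fun x => Set.indicator_nonneg (fun y _ => levelStep_nonneg _) x)
    (fun x => Set.indicator_le' (g := fun _ => 1) (fun y _ => levelStep_le_one _)
      (fun _ _ => zero_le_one) x) a ρ hρ
    (h1.trans (measureReal_mono (fun x hx => ⟨by
        simp only [Set.mem_ofPred_eq, hf]
        rw [Set.indicator_of_mem hx.1.1]
        exact levelStep_eq_one hh hx.1.2, hx.2⟩)
      (measure_mono Set.inter_subset_right |>.trans_lt measure_ball_lt_top).ne))
    ((measureReal_mono (fun x hx => by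
        have hx1 : f x ≠ 0 := hx.1
        have hxΩ : x ∈ Ω := Set.mem_of_indicator_ne_zero hx1
        refine ⟨⟨hxΩ, ?_⟩, hx.2⟩
        rw [hf, Set.indicator_of_mem hxΩ] at hx1
        exact not_le.1 fun hle => hx1 (levelStep_eq_zero hh hle))
      (measure_mono Set.inter_subset_right |>.trans_lt measure_ball_lt_top).ne).trans h2)
  set κ : EuclideanSpace ℝ (Fin n) → ℝ :=
    fun y => (n - 1) * (‖y - a‖ ^ 2 + ρ ^ 2) ^ (p - 1) with hκ
  have hκeq : ∀ x, (n - 1) * (‖x - a‖ ^ 2 + ρ ^ 2) ^ p - κ x * ‖x - a‖ ^ 2 =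
      (n - 1) * ((‖x - a‖ ^ 2 + ρ ^ 2) ^ (p - 1) * ρ ^ 2) := fun x => by
    have hpos : 0 < ‖x - a‖ ^ 2 + ρ ^ 2 := by positivity
    have e : (‖x - a‖ ^ 2 + ρ ^ 2) ^ p =
        (‖x - a‖ ^ 2 + ρ ^ 2) ^ (p - 1) * (‖x - a‖ ^ 2 + ρ ^ 2) := by
      nth_rewrite 3 [← Real.rpow_one (‖x - a‖ ^ 2 + ρ ^ 2)]
      rw [← Real.rpow_add hpos, sub_add_cancel]
    rw [e, hκ]; ring
  have key := integral_mul_sqrt_gradSq_le (a := a) (κ := κ) hu hθs hθ0 hθc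
    (contDiff_norm_sq_add_rpow (a := a) hρ p) (fun x => by positivity) hτs.continuous
    (hasCompactSupport_indicator_comp hΩb)
    (fun i x => pd_indicator_comp hu hΩ hu0 ht₀ hφ0' hφs' i x)
    (continuous_const.mul (contDiff_norm_sq_add_rpow hρ _).continuous)
    (fun x => by positivity)
    (fun i x => by rw [pd_norm_sq_add_rpow hρ, hκ, hp]; ring)
    (fun x => by rw [hκeq]; positivity)
  simp only [hκeq] at key
  have cq := (contDiff_gradSq hu).continuous
  have ilhs : Integrable fun x => θ x * (Real.sqrt (gradSq u x) *
      ((n - 1) * ((‖x - a‖ ^ 2 + ρ ^ 2) ^ (p - 1) * ρ ^ 2))) :=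
    (hθs.continuous.mul (cq.sqrt.mul (continuous_const.mul
      ((contDiff_norm_sq_add_rpow hρ _).continuous.mul
        continuous_const)))).integrable_of_hasCompactSupport hθc.mul_right
  have iθ : Integrable fun x => θ x * Real.sqrt (gradSq u x) :=
    (hθs.continuous.mul cq.sqrt).integrable_of_hasCompactSupport hθc.mul_right
  have hlow : (n - 1) * 5 ^ (p - 1) * (ρ ^ (n - 1))⁻¹ * ∫ x in Metric.ball a (2 * ρ), ‖fderiv ℝ f x‖
      ≤ ∫ x, θ x * (Real.sqrt (gradSq u x) *
        ((n - 1) * ((‖x - a‖ ^ 2 + ρ ^ 2) ^ (p - 1) * ρ ^ 2))) := by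
    simp only [hDf]
    rw [← integral_const_mul]
    refine (setIntegral_mono_on (iθ.integrableOn.const_mul _) ilhs.integrableOn
      measurableSet_ball fun x hx => ?_).trans (setIntegral_le_integral ilhs
        (Eventually.of_forall fun x => mul_nonneg (hθ0 x) (by positivity)))
    have h3 := le_rpow_mul_sq_of_mem_ball hn hρ hx
    have h4 : 0 ≤ θ x * Real.sqrt (gradSq u x) * (n - 1) := by have := hθ0 x; positivity
    have h5 := mul_le_mul_of_nonneg_left h3 h4
    linarith
  have hSm : MeasurableSet (Ω ∩ {x | t₀ ≤ u x ∧ u x < t₀ + h}) :=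
    hΩ.measurableSet.inter ((measurableSet_le measurable_const hu.continuous.measurable).inter
      (measurableSet_lt hu.continuous.measurable measurable_const))
  have hup : ∫ x, θ x * ((‖x - a‖ ^ 2 + ρ ^ 2) ^ p * ‖x - a‖) * |tangLap 0 u x| ≤
      L / h * ∫ x in Ω ∩ {x | t₀ ≤ u x ∧ u x < t₀ + h},
        (‖x - a‖ ^ (n - 2))⁻¹ * |tangLap 0 u x| := by
    rw [← integral_const_mul, ← integral_indicator hSm]
    refine integral_mono (integrable_mul_abs_tangLap hu (hθs.continuous.mul
      ((contDiff_norm_sq_add_rpow hρ _).continuous.mul (by fun_prop))) hθc.mul_right le_rfl)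
      ((integrable_indicator_iff hSm).2
        ((hwint.mono_set Set.inter_subset_left).const_mul _)) fun x => ?_
    by_cases hx : x ∈ Ω ∩ {x | t₀ ≤ u x ∧ u x < t₀ + h}
    · rw [Set.indicator_of_mem hx]
      have h3 : θ x ≤ L / h := by
        rw [hθ, Set.indicator_of_mem hx.1]
        exact deriv_levelStep_le hL hh _
      rw [← mul_assoc (L / h)]
      exact mul_le_mul_of_nonneg_right (mul_le_mul h3 (rpow_mul_norm_sub_le hn x)
        (by positivity) (by positivity)) (abs_nonneg _)
    · rw [Set.indicator_of_notMem hx]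
      have h3 : θ x = 0 := by
        by_cases hxΩ : x ∈ Ω
        · rw [hθ, Set.indicator_of_mem hxΩ]
          by_cases hlt : u x < t₀
          · exact hφ0' _ hlt
          · refine deriv_levelStep_eq_zero_of_le hh (not_lt.1 fun hlt2 => hx ⟨hxΩ, ?_, hlt2⟩)
            exact not_lt.1 hlt
        · rw [hθ, Set.indicator_of_notMem hxΩ]
      rw [h3, zero_mul, zero_mul]
  have hfinal := hlow.trans (key.trans hup)
  have hc' : c * ((n - 1) * 5 ^ (p - 1)) ≤ L / h * ∫ x in Ω ∩ {x | t₀ ≤ u x ∧ u x < t₀ + h},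
        (‖x - a‖ ^ (n - 2))⁻¹ * |tangLap 0 u x| := by
    refine le_trans ?_ hfinal
    calc c * ((n - 1) * 5 ^ (p - 1))
        = (n - 1) * 5 ^ (p - 1) * (ρ ^ (n - 1))⁻¹ * (c * ρ ^ (n - 1)) := by field_simp
      _ ≤ _ := mul_le_mul_of_nonneg_left hI (by positivity)
  rw [div_mul_eq_mul_div, le_div_iff₀ hh] at hc'
  rw [div_mul_eq_mul_div, div_le_iff₀ hL0]
  linarith

theorem Monotone.mul_sub_le_of_exists_step {G : ℝ → ℝ} {c s M : ℝ} (hG : Monotone G) (hc : 0 < c)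
    (h0 : 0 ≤ G s) (hsM : s ≤ M)
    (step : ∀ t, s ≤ t → t < M → ∃ h, 0 < h ∧ t + h ≤ M ∧ c * h ≤ G (t + h) - G t) :
    c * (M - s) ≤ G M := by
  set A : Set ℝ := {t | s ≤ t ∧ t ≤ M ∧ c * (t - s) ≤ G t} with hA
  have hsA : s ∈ A := ⟨le_rfl, hsM, by simpa using h0⟩
  have hbdd : BddAbove A := ⟨M, fun t ht => ht.2.1⟩
  have h1 : s ≤ sSup A := le_csSup hbdd hsA
  have h2 : sSup A ≤ M := csSup_le ⟨s, hsA⟩ fun t ht => ht.2.1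
  have h3 : sSup A ≤ s + G (sSup A) / c := csSup_le ⟨s, hsA⟩ fun t ht => by
    have h4 := hG (le_csSup hbdd ht)
    have h5 : t - s ≤ G (sSup A) / c := by
      rw [le_div_iff₀ hc]; linarith [ht.2.2]
    linarith
  have h4 : c * (sSup A - s) ≤ G (sSup A) := by
    have : sSup A - s ≤ G (sSup A) / c := by linarith
    rw [le_div_iff₀ hc] at this
    linarith
  rcases h2.eq_or_lt with h | h
  · rwa [h] at h4
  · obtain ⟨d, hd, hdM, hstep⟩ := step _ h1 h
    have : sSup A + d ∈ A := ⟨by linarith, hdM, by linarith⟩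
    linarith [le_csSup hbdd this]

section Density

variable {n : ℕ}

theorem exists_radius_of_density (hn : 2 ≤ n) {D : Set (EuclideanSpace ℝ (Fin n))}
    (hD : IsOpen D) (hDb : IsBounded D) {a : EuclideanSpace ℝ (Fin n)} (ha : a ∈ D) {σ : ℝ}
    (hσ : 0 < σ) (hσ1 : σ ≤ 1) :
    ∃ ρ : ℝ, 0 < ρ ∧ σ * volume.real (Metric.ball a ρ) ≤ volume.real (D ∩ Metric.ball a ρ) ∧
      volume.real (D ∩ Metric.ball a (2 * ρ)) ≤ σ * volume.real (Metric.ball a (2 * ρ)) := by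
  obtain ⟨r, hr, hrD⟩ := Metric.isOpen_iff.1 hD a ha
  set β := volume.real (Metric.ball (0 : EuclideanSpace ℝ (Fin n)) 1) with hβ
  have hβ0 : 0 < β := ENNReal.toReal_pos (Metric.measure_ball_pos _ _ one_pos).ne'
    measure_ball_lt_top.ne
  have hball : ∀ ρ : ℝ, 0 < ρ → volume.real (Metric.ball a ρ) = ρ ^ n * β := fun ρ hρ => by
    rw [measureReal_def, Measure.addHaar_ball_of_pos _ _ hρ, ENNReal.toReal_mul,
      ENNReal.toReal_ofReal (by positivity), finrank_euclideanSpace_fin, hβ, measureReal_def]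
  have hex : ∃ k : ℕ, volume.real (D ∩ Metric.ball a (2 ^ k * r)) <
      σ * volume.real (Metric.ball a (2 ^ k * r)) := by
    have hlim : Tendsto (fun k : ℕ => σ * ((2 ^ k * r) ^ n * β)) atTop atTop := by
      refine Tendsto.const_mul_atTop hσ (Tendsto.atTop_mul_const hβ0 ?_)
      exact (tendsto_pow_atTop (by omega)).comp
        ((tendsto_pow_atTop_atTop_of_one_lt (by norm_num)).atTop_mul_const hr)
    obtain ⟨k, hk⟩ := (hlim.eventually_gt_atTop (volume.real D)).exists
    refine ⟨k, ?_⟩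
    rw [hball _ (by positivity)]
    exact (measureReal_mono Set.inter_subset_left hDb.measure_lt_top.ne).trans_lt hk
  classical
  have h0 : Nat.find hex ≠ 0 := fun h => by
    have h1 := Nat.find_spec hex
    rw [h, pow_zero, one_mul, Set.inter_eq_right.2 hrD] at h1
    exact absurd h1 (not_lt.2 (mul_le_of_le_one_left measureReal_nonneg hσ1))
  obtain ⟨k, hk⟩ := Nat.exists_eq_succ_of_ne_zero h0
  refine ⟨2 ^ k * r, by positivity, not_lt.1 (Nat.find_min hex (m := k) (by omega)), ?_⟩
  have h1 := Nat.find_spec hex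
  rw [hk, pow_succ', mul_assoc] at h1
  exact h1.le

theorem exists_level_of_density {u : EuclideanSpace ℝ (Fin n) → ℝ}
    {Ω : Set (EuclideanSpace ℝ (Fin n))} {a : EuclideanSpace ℝ (Fin n)} {σ ρ t₀ M : ℝ}
    (hσ : 0 < σ) (hρ : 0 < ρ) (hM : t₀ < M)
    (h : σ * volume.real (Metric.ball a ρ) ≤
      volume.real ((Ω ∩ {x | t₀ < u x}) ∩ Metric.ball a ρ)) :
    ∃ d, 0 < d ∧ t₀ + d ≤ M ∧ σ / 2 * volume.real (Metric.ball a ρ) ≤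
      volume.real ((Ω ∩ {x | t₀ + d ≤ u x}) ∩ Metric.ball a ρ) := by
  set d : ℕ → ℝ := fun k => (M - t₀) * (1 / ((k : ℝ) + 1)) with hd
  have hd0 : ∀ k, 0 < d k := fun k => mul_pos (by linarith) (by positivity)
  have hd1 : ∀ k, d k ≤ M - t₀ := fun k =>
    mul_le_of_le_one_right (by linarith)
      ((div_le_one (by positivity)).2 (by linarith [(Nat.cast_nonneg k : (0 : ℝ) ≤ k)]))
  set S : ℕ → Set (EuclideanSpace ℝ (Fin n)) := fun k =>
    (Ω ∩ {x | t₀ + d k ≤ u x}) ∩ Metric.ball a ρ with hS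
  have hSm : Monotone S := fun j k hjk x hx => by
    refine ⟨⟨hx.1.1, ?_⟩, hx.2⟩
    have h1 : t₀ + d j ≤ u x := hx.1.2
    have h2 : d k ≤ d j := mul_le_mul_of_nonneg_left
      (one_div_le_one_div_of_le (by positivity)
        (by have : (j : ℝ) ≤ k := by exact_mod_cast hjk
            linarith)) (by linarith)
    show t₀ + d k ≤ u x
    linarith
  have hU : ⋃ k, S k = (Ω ∩ {x | t₀ < u x}) ∩ Metric.ball a ρ := by
    ext x
    simp only [Set.mem_iUnion]
    constructor
    · rintro ⟨k, hk⟩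
      refine ⟨⟨hk.1.1, ?_⟩, hk.2⟩
      have h1 : t₀ + d k ≤ u x := hk.1.2
      have := hd0 k
      show t₀ < u x
      linarith
    · rintro ⟨⟨h1, h2⟩, h3⟩
      have h2 : t₀ < u x := h2
      have hlim : Tendsto d atTop (𝓝 ((M - t₀) * 0)) :=
        tendsto_one_div_add_atTop_nhds_zero_nat.const_mul _
      rw [mul_zero] at hlim
      obtain ⟨k, hk⟩ := (hlim.eventually_lt_const (show 0 < u x - t₀ by linarith)).exists
      exact ⟨k, ⟨h1, show t₀ + d k ≤ u x by linarith⟩, h3⟩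
  have hfin : volume ((Ω ∩ {x | t₀ < u x}) ∩ Metric.ball a ρ) ≠ ⊤ :=
    (measure_mono Set.inter_subset_right |>.trans_lt measure_ball_lt_top).ne
  have hlim := (ENNReal.tendsto_toReal (hU ▸ hfin)).comp
    (tendsto_measure_iUnion_atTop (μ := volume) hSm)
  rw [hU] at hlim
  have hB : 0 < volume.real (Metric.ball a ρ) :=
    ENNReal.toReal_pos (Metric.measure_ball_pos _ _ hρ).ne' measure_ball_lt_top.ne
  have hlt : σ / 2 * volume.real (Metric.ball a ρ) <
      (volume ((Ω ∩ {x | t₀ < u x}) ∩ Metric.ball a ρ)).toReal := by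
    refine lt_of_lt_of_le ?_ h
    nlinarith
  obtain ⟨k, hk⟩ := (hlim.eventually_const_lt hlt).exists
  exact ⟨d k, hd0 k, by linarith [hd1 k], hk.le⟩

end Density

theorem exists_mul_sub_le_setIntegral {n : ℕ} (hn : 2 ≤ n) :
    ∃ c : ℝ, 0 < c ∧
      ∀ (u : EuclideanSpace ℝ (Fin n) → ℝ) (Ω : Set (EuclideanSpace ℝ (Fin n))),
        ContDiff ℝ (⊤ : ℕ∞) u → IsOpen Ω → IsBounded Ω → (∀ x ∈ frontier Ω, u x = 0) →
        ∀ (a : EuclideanSpace ℝ (Fin n)) (s : ℝ), a ∈ Ω → 0 < s → s ≤ u a →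
          IntegrableOn (fun x => (‖x - a‖ ^ (n - 2))⁻¹ * |tangLap 0 u x|) Ω →
          c * (u a - s) ≤ ∫ x in Ω ∩ {x | s ≤ u x}, (‖x - a‖ ^ (n - 2))⁻¹ * |tangLap 0 u x| := by
  obtain ⟨c, σ, hc, hσ, hσ1, hgrow⟩ := exists_mul_le_setIntegral_of_density hn
  refine ⟨c, hc, fun u Ω hu hΩ hΩb hu0 a s ha hs hsa hwint => ?_⟩
  set W : EuclideanSpace ℝ (Fin n) → ℝ :=
    fun x => (‖x - a‖ ^ (n - 2))⁻¹ * |tangLap 0 u x| with hW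
  have hW0 : ∀ x, 0 ≤ W x := fun x => by positivity
  have hm : ∀ t t', MeasurableSet (Ω ∩ {x | t ≤ u x ∧ u x < t'}) := fun t t' =>
    hΩ.measurableSet.inter ((measurableSet_le measurable_const hu.continuous.measurable).inter
      (measurableSet_lt hu.continuous.measurable measurable_const))
  have hsub : ∀ S, IntegrableOn W (Ω ∩ S) := fun S => hwint.mono_set Set.inter_subset_left
  have hmono : Monotone fun t => ∫ x in Ω ∩ {x | s ≤ u x ∧ u x < t}, W x := fun t t' htt => by
    refine setIntegral_mono_set (hsub _) (Eventually.of_forall hW0) (Eventually.of_forall ?_)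
    exact fun x hx => ⟨hx.1, hx.2.1, hx.2.2.trans_le htt⟩
  have hmain := hmono.mul_sub_le_of_exists_step hc
    (integral_nonneg fun x => hW0 x) hsa fun t hst hta => by
      have hDo : IsOpen (Ω ∩ {x | t < u x}) := hΩ.inter (isOpen_lt continuous_const hu.continuous)
      obtain ⟨ρ, hρ, h1, h2⟩ := exists_radius_of_density hn hDo
        (hΩb.subset Set.inter_subset_left) (a := a) ⟨ha, hta⟩ hσ hσ1
      obtain ⟨d, hd, hdM, h3⟩ := exists_level_of_density hσ hρ hta h1
      refine ⟨d, hd, hdM, ?_⟩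
      have h4 := hgrow u Ω hu hΩ hΩb hu0 a ρ t d hρ (hs.trans_le hst) hd hwint h3 h2
      have h5 : Ω ∩ {x | s ≤ u x ∧ u x < t + d} =
          (Ω ∩ {x | s ≤ u x ∧ u x < t}) ∪ (Ω ∩ {x | t ≤ u x ∧ u x < t + d}) := by
        ext x
        simp only [Set.mem_inter_iff, Set.mem_union, Set.mem_ofPred_eq]
        constructor
        · rintro ⟨hx, h6, h7⟩
          rcases lt_or_ge (u x) t with h8 | h8
          · exact Or.inl ⟨hx, h6, h8⟩
          · exact Or.inr ⟨hx, h8, h7⟩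
        · rintro (⟨hx, h6, h7⟩ | ⟨hx, h6, h7⟩)
          · exact ⟨hx, h6, by linarith⟩
          · exact ⟨hx, by linarith, h7⟩
      have hdisj : Disjoint (Ω ∩ {x | s ≤ u x ∧ u x < t}) (Ω ∩ {x | t ≤ u x ∧ u x < t + d}) :=
        Set.disjoint_left.2 fun x hx hx' => absurd hx.2.2 (not_lt.2 hx'.2.1)
      simp only [h5]
      rw [setIntegral_union hdisj (hm _ _) (hsub _) (hsub _)]
      linarith
  refine hmain.trans ?_
  refine setIntegral_mono_set (hsub _) (Eventually.of_forall hW0) (Eventually.of_forall ?_)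
  exact fun x hx => ⟨hx.1, hx.2.1⟩

theorem integral_indicator_inv_sq_norm_sub (a : EuclideanSpace ℝ (Fin 3)) {R : ℝ} (hR : 0 < R) :
    (Integrable fun x => (Set.Iio R).indicator (fun y : ℝ => (y ^ 2)⁻¹) ‖x - a‖) ∧
    ∫ x, (Set.Iio R).indicator (fun y : ℝ => (y ^ 2)⁻¹) ‖x - a‖ =
      3 * volume.real (Metric.ball (0 : EuclideanSpace ℝ (Fin 3)) 1) * R := by
  have hcongr : Set.EqOn (fun y : ℝ => y ^ 2 • (Set.Iio R).indicator (fun y : ℝ => (y ^ 2)⁻¹) y)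
      ((Set.Iio R).indicator fun _ => 1) (Set.Ioi 0) := fun y hy => by
    have hy0 : y ≠ 0 := ne_of_gt hy
    by_cases hyR : y ∈ Set.Iio R
    · simp only [Set.indicator_of_mem hyR, smul_eq_mul]
      field_simp
    · simp only [Set.indicator_of_notMem hyR, smul_zero]
  have hfin : Module.finrank ℝ (EuclideanSpace ℝ (Fin 3)) - 1 = 2 := by
    rw [finrank_euclideanSpace_fin]
  have hI : Set.Ioi (0 : ℝ) ∩ Set.Iio R = Set.Ioo 0 R := Set.Ioi_inter_Iio
  constructor
  · refine Integrable.comp_sub_right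
      (f := fun x => (Set.Iio R).indicator (fun y : ℝ => (y ^ 2)⁻¹) ‖x‖) ?_ a
    refine (integrable_fun_norm_addHaar (μ := volume)
      (f := (Set.Iio R).indicator (fun y : ℝ => (y ^ 2)⁻¹))).2 ?_
    rw [hfin]
    refine IntegrableOn.congr_fun ?_ hcongr.symm measurableSet_Ioi
    rw [IntegrableOn, integrable_indicator_iff measurableSet_Iio, IntegrableOn,
      Measure.restrict_restrict measurableSet_Iio, Set.inter_comm, hI]
    exact integrableOn_const (by simp)
  · rw [integral_sub_right_eq_self
      (fun x => (Set.Iio R).indicator (fun y : ℝ => (y ^ 2)⁻¹) ‖x‖) a,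
      integral_fun_norm_addHaar volume ((Set.Iio R).indicator (fun y : ℝ => (y ^ 2)⁻¹)), hfin,
      setIntegral_congr_fun measurableSet_Ioi hcongr, setIntegral_indicator measurableSet_Iio, hI,
      finrank_euclideanSpace_fin]
    simp [hR.le]
    ring

theorem exists_setIntegral_sq_weight_le {n : ℕ} (hn : n = 2 ∨ n = 3) :
    ∃ C : ℝ, 0 < C ∧ ∀ (Ω : Set (EuclideanSpace ℝ (Fin n))) (a : EuclideanSpace ℝ (Fin n)),
      MeasurableSet Ω → IsBounded Ω → 0 < volume.real Ω →
        IntegrableOn (fun x => (‖x - a‖ ^ (n - 2))⁻¹ ^ 2) Ω ∧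
        ∫ x in Ω, (‖x - a‖ ^ (n - 2))⁻¹ ^ 2 ≤ C * volume.real Ω ^ ((4 - (n : ℝ)) / n) := by
  rcases hn with rfl | rfl
  · refine ⟨1, one_pos, fun Ω a hΩ hΩb hpos => ?_⟩
    constructor
    · have h : IntegrableOn (fun _ : EuclideanSpace ℝ (Fin 2) => (1 : ℝ)) Ω :=
        integrableOn_const hΩb.measure_lt_top.ne
      simpa using h
    · have : (4 - ((2 : ℕ) : ℝ)) / (2 : ℕ) = 1 := by norm_num
      rw [this]
      simp
  · refine ⟨3 * volume.real (Metric.ball (0 : EuclideanSpace ℝ (Fin 3)) 1) + 1, by positivity,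
      fun Ω a hΩ hΩb hpos => ?_⟩
    set R : ℝ := volume.real Ω ^ ((1 : ℝ) / 3) with hR
    have hR0 : 0 < R := by positivity
    have hR3 : volume.real Ω = R ^ 3 := by
      rw [hR, ← Real.rpow_natCast, ← Real.rpow_mul hpos.le]; norm_num
    obtain ⟨hi, he⟩ := integral_indicator_inv_sq_norm_sub a hR0
    have hsum : IntegrableOn (fun x =>
        (Set.Iio R).indicator (fun y : ℝ => (y ^ 2)⁻¹) ‖x - a‖ + (R ^ 2)⁻¹) Ω :=
      hi.integrableOn.add (integrableOn_const hΩb.measure_lt_top.ne)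
    have hle : ∀ x : EuclideanSpace ℝ (Fin 3), (‖x - a‖ ^ (3 - 2))⁻¹ ^ 2 ≤
        (Set.Iio R).indicator (fun y : ℝ => (y ^ 2)⁻¹) ‖x - a‖ + (R ^ 2)⁻¹ := fun x => by
      have e : (‖x - a‖ ^ (3 - 2))⁻¹ ^ 2 = (‖x - a‖ ^ 2)⁻¹ := by norm_num
      rw [e]
      by_cases h : ‖x - a‖ ∈ Set.Iio R
      · rw [Set.indicator_of_mem h]
        linarith [show 0 < (R ^ 2)⁻¹ by positivity]
      · rw [Set.indicator_of_notMem h, zero_add]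
        have : R ≤ ‖x - a‖ := not_lt.1 h
        gcongr
    have hwi : IntegrableOn (fun x : EuclideanSpace ℝ (Fin 3) => (‖x - a‖ ^ (3 - 2))⁻¹ ^ 2) Ω := by
      refine Integrable.mono' hsum ?_ (Eventually.of_forall fun x => ?_)
      · exact (by fun_prop : Measurable fun x : EuclideanSpace ℝ (Fin 3) =>
          (‖x - a‖ ^ (3 - 2))⁻¹ ^ 2).aestronglyMeasurable
      · rw [Real.norm_of_nonneg (by positivity)]
        exact hle x
    refine ⟨hwi, ?_⟩
    have hexp : (4 - ((3 : ℕ) : ℝ)) / (3 : ℕ) = 1 / 3 := by norm_num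
    rw [hexp, ← hR]
    have h1 := setIntegral_mono hwi hsum hle
    have h2 : ∫ x in Ω, ((Set.Iio R).indicator (fun y : ℝ => (y ^ 2)⁻¹) ‖x - a‖ + (R ^ 2)⁻¹) =
        (∫ x in Ω, (Set.Iio R).indicator (fun y : ℝ => (y ^ 2)⁻¹) ‖x - a‖)
          + volume.real Ω * (R ^ 2)⁻¹ := by
      rw [integral_add hi.integrableOn (integrableOn_const hΩb.measure_lt_top.ne),
        setIntegral_const, smul_eq_mul]
    have h3 : ∫ x in Ω, (Set.Iio R).indicator (fun y : ℝ => (y ^ 2)⁻¹) ‖x - a‖ ≤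
        ∫ x, (Set.Iio R).indicator (fun y : ℝ => (y ^ 2)⁻¹) ‖x - a‖ :=
      setIntegral_le_integral hi (Eventually.of_forall fun x =>
        Set.indicator_nonneg (fun y _ => by positivity) _)
    have h4 : volume.real Ω * (R ^ 2)⁻¹ = R := by
      rw [hR3]; field_simp
    rw [h2, h4] at h1
    rw [he] at h3
    linarith

theorem setIntegral_mul_abs_le_sqrt {n : ℕ} {w h : EuclideanSpace ℝ (Fin n) → ℝ}
    {S : Set (EuclideanSpace ℝ (Fin n))} (hw : Measurable w) (hh : Measurable h)
    (hw0 : ∀ x, 0 ≤ w x) (hwi : IntegrableOn (fun x => w x ^ 2) S)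
    (hhi : IntegrableOn (fun x => h x ^ 2) S) :
    IntegrableOn (fun x => w x * |h x|) S ∧
    ∫ x in S, w x * |h x| ≤
      (∫ x in S, w x ^ 2) ^ ((1 : ℝ) / 2) * (∫ x in S, h x ^ 2) ^ ((1 : ℝ) / 2) := by
  have m1 : MemLp w 2 (volume.restrict S) :=
    (memLp_two_iff_integrable_sq hw.aestronglyMeasurable).2 hwi
  have m2 : MemLp (fun x => |h x|) 2 (volume.restrict S) :=
    ((memLp_two_iff_integrable_sq hh.aestronglyMeasurable).2 hhi).abs
  refine ⟨m1.integrable_mul m2, ?_⟩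
  have hpq : Real.HolderConjugate 2 2 := Real.HolderConjugate.two_two
  have := integral_mul_le_Lp_mul_Lq_of_nonneg hpq (μ := volume.restrict S)
    (Eventually.of_forall hw0) (Eventually.of_forall fun x => abs_nonneg (h x))
    (by simpa using m1) (by simpa using m2)
  simpa using this

theorem exists_sub_le_mul {n : ℕ} (hn : n = 2 ∨ n = 3) :
    ∃ C : ℝ, 0 < C ∧
      ∀ (Ω : Set (EuclideanSpace ℝ (Fin n))), IsOpen Ω → IsBounded Ω →
        ∀ g : ℝ → ℝ, ContDiff ℝ (⊤ : ℕ∞) g →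
          ∀ u : EuclideanSpace ℝ (Fin n) → ℝ, ContDiff ℝ (⊤ : ℕ∞) u →
            (∀ x ∈ Ω, -lap u x = g (u x)) → (∀ x ∈ frontier Ω, u x = 0) → SemiStable Ω g u →
            ∀ s : ℝ, 0 < s → ∀ a ∈ Ω, s ≤ u a →
              u a - s ≤ C / s * (volume Ω).toReal ^ ((4 - (n : ℝ)) / (2 * n)) *
                (∫ x in Ω ∩ {x | |u x| ≤ s}, ‖gradient u x‖ ^ 4) ^ ((1 : ℝ) / 2) := by
  have hn2 : 2 ≤ n := by omega
  have hn0 : (0 : ℝ) < n := by positivity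
  obtain ⟨c, hc, hgrow⟩ := exists_mul_sub_le_setIntegral hn2
  obtain ⟨L, hL0, hL⟩ := exists_abs_deriv_smoothTransition_le
  obtain ⟨W, hW0, hW⟩ := exists_setIntegral_sq_weight_le hn
  refine ⟨W ^ ((1 : ℝ) / 2) * (n : ℝ) ^ ((1 : ℝ) / 2) * (2 * L) / c, by positivity,
    fun Ω hΩ hΩb g hg u hu heq hu0 hst s hs a ha hsa => ?_⟩
  have hvol : 0 < volume.real Ω :=
    ENNReal.toReal_pos (hΩ.measure_pos volume ⟨a, ha⟩).ne' hΩb.measure_lt_top.ne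
  obtain ⟨hwi, hwle⟩ := hW Ω a hΩ.measurableSet hΩb hvol
  obtain ⟨hTi, hTle⟩ := setIntegral_tangHess_le hL hΩ hΩb hg hu heq hu0 hst hs
  set J := ∫ x in Ω ∩ {x | |u x| ≤ s}, ‖gradient u x‖ ^ 4 with hJ
  have hJ0 : 0 ≤ J := integral_nonneg fun x => by positivity
  have hwm : Measurable fun x : EuclideanSpace ℝ (Fin n) => (‖x - a‖ ^ (n - 2))⁻¹ := by fun_prop
  have hhi : IntegrableOn (fun x => tangLap 0 u x ^ 2) Ω := by
    refine Integrable.mono' (((continuous_sum_hess_sq hu).const_mul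
      (n : ℝ)).integrableOn_of_isBounded hΩb)
      ((measurable_tangLap hu).pow_const 2).aestronglyMeasurable (Eventually.of_forall fun x => ?_)
    rw [Real.norm_of_nonneg (sq_nonneg _)]
    exact (sq_tangLap_le le_rfl x).trans
      (mul_le_mul_of_nonneg_left (tangHess_le le_rfl x) hn0.le)
  have hwint := (setIntegral_mul_abs_le_sqrt hwm (measurable_tangLap hu)
    (fun x => by positivity) hwi hhi).1
  have h1 := hgrow u Ω hu hΩ hΩb hu0 a s ha hs hsa hwint
  have h2 := (setIntegral_mul_abs_le_sqrt hwm (measurable_tangLap hu)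
    (fun x => by positivity) (hwi.mono_set (Set.inter_subset_left (t := {x | s ≤ u x})))
    (hhi.mono_set Set.inter_subset_left)).2
  have h3 : ∫ x in Ω ∩ {x | s ≤ u x}, (‖x - a‖ ^ (n - 2))⁻¹ ^ 2 ≤
      W * volume.real Ω ^ ((4 - (n : ℝ)) / n) :=
    (setIntegral_mono_set hwi (Eventually.of_forall fun x => by positivity)
      (Eventually.of_forall fun x hx => hx.1)).trans hwle
  have h4 : ∫ x in Ω ∩ {x | s ≤ u x}, tangLap 0 u x ^ 2 ≤ n * ((2 * L / s) ^ 2 * J) := by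
    refine (setIntegral_mono (hhi.mono_set Set.inter_subset_left) (hTi.const_mul (n : ℝ))
      fun x => sq_tangLap_le le_rfl x).trans ?_
    rw [integral_const_mul]
    gcongr
  have h5 : c * (u a - s) ≤ (W * volume.real Ω ^ ((4 - (n : ℝ)) / n)) ^ ((1 : ℝ) / 2) *
      (n * ((2 * L / s) ^ 2 * J)) ^ ((1 : ℝ) / 2) := by
    refine h1.trans (h2.trans ?_)
    gcongr
  have h6 : (W * volume.real Ω ^ ((4 - (n : ℝ)) / n)) ^ ((1 : ℝ) / 2) =
      W ^ ((1 : ℝ) / 2) * volume.real Ω ^ ((4 - (n : ℝ)) / (2 * n)) := by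
    rw [Real.mul_rpow hW0.le (by positivity), ← Real.rpow_mul hvol.le]
    congr 2
    field_simp
  have h7 : (n * ((2 * L / s) ^ 2 * J)) ^ ((1 : ℝ) / 2) =
      (n : ℝ) ^ ((1 : ℝ) / 2) * (2 * L / s * J ^ ((1 : ℝ) / 2)) := by
    rw [Real.mul_rpow hn0.le (by positivity), Real.mul_rpow (by positivity) hJ0,
      ← Real.sqrt_eq_rpow ((2 * L / s) ^ 2), Real.sqrt_sq (by positivity)]
  rw [h6, h7] at h5
  rw [← measureReal_def]
  refine le_of_mul_le_mul_left (h5.trans (le_of_eq ?_)) hc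
  field_simp

theorem norm_gradient_neg {n : ℕ} (f : EuclideanSpace ℝ (Fin n) → ℝ)
    (x : EuclideanSpace ℝ (Fin n)) : ‖gradient (fun y => -f y) x‖ = ‖gradient f x‖ := by
  simp only [gradient, fderiv_fun_neg, map_neg, norm_neg]

theorem lap_neg {n : ℕ} {f : EuclideanSpace ℝ (Fin n) → ℝ} (hf : ContDiff ℝ (⊤ : ℕ∞) f)
    (x : EuclideanSpace ℝ (Fin n)) : lap (fun y => -f y) x = -lap f x := by
  rw [lap_eq_sum_pd hf.neg, lap_eq_sum_pd hf, ← Finset.sum_neg_distrib]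
  have hpd (h : EuclideanSpace ℝ (Fin n) → ℝ) (i : Fin n) :
      pd i (fun y => -h y) = fun y => -pd i h y := by
    funext y
    simp [pd, fderiv_fun_neg]
  exact Finset.sum_congr rfl fun i _ => by rw [hpd, hpd]

theorem SemiStable.neg {n : ℕ} {Ω : Set (EuclideanSpace ℝ (Fin n))} {g : ℝ → ℝ}
    {u : EuclideanSpace ℝ (Fin n) → ℝ} (h : SemiStable Ω g u) :
    SemiStable Ω (fun t => -g (-t)) (fun x => -u x) := fun ξ hξ hξ0 => by
  have hd (t : ℝ) : deriv (fun t => -g (-t)) (-t) = deriv g t := by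
    rw [deriv.fun_neg, deriv_comp_neg, neg_neg, neg_neg]
  simpa only [hd] using h ξ hξ hξ0

/-- The `L^∞` estimate (1.6) in dimensions `n ∈ {2,3}`:
`‖u‖_{L^∞(Ω)} ≤ s + (C(n)/s) |Ω|^{(4-n)/(2n)} (∫_{{|u|≤s}} |∇u|⁴ dx)^{1/2}` for every `s > 0`. -/
theorem stmt_12 (n : ℕ) (hn : n = 2 ∨ n = 3) :
    ∃ C : ℝ, 0 < C ∧
      ∀ (Ω : Set (EuclideanSpace ℝ (Fin n))), IsOpen Ω → IsBounded Ω →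
        ∀ g : ℝ → ℝ, ContDiff ℝ (⊤ : ℕ∞) g →
          ∀ u : EuclideanSpace ℝ (Fin n) → ℝ, ContDiff ℝ (⊤ : ℕ∞) u →
            (∀ x ∈ Ω, -lap u x = g (u x)) →
            (∀ x ∈ frontier Ω, u x = 0) →
            SemiStable Ω g u →
            ∀ s : ℝ, 0 < s →
              (eLpNorm u ⊤ (volume.restrict Ω)).toReal ≤
                s + C / s * (volume Ω).toReal ^ ((4 - (n : ℝ)) / (2 * n)) *
                  (∫ x in Ω ∩ {x | |u x| ≤ s}, ‖gradient u x‖ ^ 4) ^ ((1 : ℝ) / 2) := by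
  obtain ⟨C, hC, h⟩ := exists_sub_le_mul hn
  refine ⟨C, hC, fun Ω hΩ hΩb g hg u hu heq hu0 hst s hs => ?_⟩
  have hT : 0 ≤ C / s * (volume Ω).toReal ^ ((4 - (n : ℝ)) / (2 * n)) *
      (∫ x in Ω ∩ {x | |u x| ≤ s}, ‖gradient u x‖ ^ 4) ^ ((1 : ℝ) / 2) :=
    mul_nonneg (by positivity)
      (Real.rpow_nonneg (integral_nonneg fun x => by positivity) _)
  have hbound : ∀ x ∈ Ω, ‖u x‖ ≤ s + C / s * (volume Ω).toReal ^ ((4 - (n : ℝ)) / (2 * n)) *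
      (∫ x in Ω ∩ {x | |u x| ≤ s}, ‖gradient u x‖ ^ 4) ^ ((1 : ℝ) / 2) := fun x hx => by
    rw [Real.norm_eq_abs]
    rcases le_total |u x| s with hle | hle
    · linarith
    rcases le_abs.1 hle with hpos | hneg
    · have := h Ω hΩ hΩb g hg u hu heq hu0 hst s hs x hx hpos
      rw [abs_of_pos (hs.trans_le hpos)]
      linarith
    · have := h Ω hΩ hΩb (fun t => -g (-t)) (hg.comp contDiff_neg).neg (fun y => -u y) hu.neg
        (fun y hy => by rw [lap_neg hu, neg_neg (u y), ← heq y hy])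
        (fun y hy => by rw [hu0 y hy, neg_zero]) hst.neg s hs x hx hneg
      simp only [abs_neg, norm_gradient_neg] at this
      rw [abs_of_neg (by linarith)]
      linarith
  refine ENNReal.toReal_le_of_le_ofReal (by linarith) ?_
  rw [eLpNorm_exponent_top]
  exact eLpNormEssSup_le_of_ae_bound (ae_restrict_of_forall_mem hΩ.measurableSet hbound)
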